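/- Let D ⊊ ℂ^n be a ℂ-convex domain, let z ∈ D and let X ∈ ℂ^n be a nonzero vector such that D does not contain the whole complex line {z + λX : λ ∈ ℂ}. Then 1/4 ≤ γ_D(z;X)·d_D(z,X) ≤ κ_D(z;X)·d_D(z,X) ≤ 1. -/

import Mathlib

open Complex Metric Set MeasureTheory

noncomputable section

/-- `ℂ^n` with the Euclidean (Hermitian) structure. -/
abbrev Cn (n : ℕ) := EuclideanSpace ℂ (Fin n)

instance (n : ℕ) : MeasurableSpace (Cn n) := borel _
instance (n : ℕ) : BorelSpace (Cn n) := ⟨rfl⟩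

/-- The complex affine line through `z` in direction `X`. -/
def cline {n : ℕ} (z X : Cn n) : Set (Cn n) := {w | ∃ l : ℂ, w = z + l • X}

/-- A domain: a nonempty connected open set. -/
def IsDomain' {n : ℕ} (D : Set (Cn n)) : Prop := IsOpen D ∧ IsConnected D

/-- `D` is ℂ-convex: its intersection with every complex affine line is, when
nonempty, connected and simply connected. -/
def IsCConvex {n : ℕ} (D : Set (Cn n)) : Prop :=
  ∀ z X : Cn n, X ≠ 0 → (D ∩ cline z X).Nonempty →
    IsConnected (D ∩ cline z X) ∧ SimplyConnectedSpace ↥(D ∩ cline z X)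

/-- The Carathéodory metric `γ_D(z;X)`. -/
def caraMetric {n : ℕ} (D : Set (Cn n)) (z X : Cn n) : ℝ :=
  sSup {r : ℝ | ∃ f : Cn n → ℂ, DifferentiableOn ℂ f D ∧ MapsTo f D (ball (0:ℂ) 1) ∧
    f z = 0 ∧ r = ‖fderiv ℂ f z X‖}

/-- The Kobayashi metric `κ_D(z;X)`. -/
def kobMetric {n : ℕ} (D : Set (Cn n)) (z X : Cn n) : ℝ :=
  sInf {a : ℝ | 0 ≤ a ∧ ∃ φ : ℂ → Cn n, DifferentiableOn ℂ φ (ball (0:ℂ) 1) ∧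
    MapsTo φ (ball (0:ℂ) 1) D ∧ φ 0 = z ∧ a • (fderiv ℂ φ 0 1) = X}

/-- The distance `d_D(z,X)` from `z` to `∂D` in direction `X`. -/
def dirDist {n : ℕ} (D : Set (Cn n)) (z X : Cn n) : ℝ :=
  sSup {r : ℝ | 0 < r ∧ ∀ l : ℂ, ‖l‖ < r → z + l • X ∈ D}

/-- The Euclidean distance `d_D(z)` from `z` to `∂D`. -/
def bdist {n : ℕ} (D : Set (Cn n)) (z : Cn n) : ℝ := Metric.infDist z (frontier D)

/-- `L_a`: the set of vectors `X` such that a disc `{a + λX : |λ| < ε}` lies in `∂D`. -/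
def La {n : ℕ} (D : Set (Cn n)) (a : Cn n) : Set (Cn n) :=
  {X | ∃ ε > (0:ℝ), ∀ l : ℂ, ‖l‖ < ε → a + l • X ∈ frontier D}

/-- `D` contains no complex affine line. -/
def NoComplexLine {n : ℕ} (D : Set (Cn n)) : Prop :=
  ¬ ∃ z X : Cn n, X ≠ 0 ∧ cline z X ⊆ D

/-- The Bergman kernel `K_D(z)` (restricted to the diagonal). -/
def bergmanKernel {n : ℕ} (D : Set (Cn n)) (z : Cn n) : ℝ :=
  sSup {r : ℝ | ∃ f : Cn n → ℂ, DifferentiableOn ℂ f D ∧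
    IntegrableOn (fun w => ‖f w‖ ^ 2) D ∧ (∫ w in D, ‖f w‖ ^ 2) ≤ 1 ∧ r = ‖f z‖ ^ 2}

/-- `M_D(z;X)`. -/
def bergmanM {n : ℕ} (D : Set (Cn n)) (z X : Cn n) : ℝ :=
  sSup {r : ℝ | ∃ f : Cn n → ℂ, DifferentiableOn ℂ f D ∧
    IntegrableOn (fun w => ‖f w‖ ^ 2) D ∧ (∫ w in D, ‖f w‖ ^ 2) = 1 ∧
    f z = 0 ∧ r = ‖fderiv ℂ f z X‖}

/-- The Bergman metric `B_D(z;X) = M_D(z;X)/√K_D(z)`. -/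
def bergmanMetric {n : ℕ} (D : Set (Cn n)) (z X : Cn n) : ℝ :=
  bergmanM D z X / Real.sqrt (bergmanKernel D z)

/-- `G` is weakly linearly convex: through every boundary point there is a complex
affine hyperplane missing `G`. -/
def WeaklyLinConvex {n : ℕ} (G : Set (Cn n)) : Prop :=
  ∀ a ∈ frontier G, ∃ ℓ : Cn n →L[ℂ] ℂ, ℓ ≠ 0 ∧ ∀ z ∈ G, ℓ z ≠ ℓ a

/-- `d_{j,D}(z)` from the minimal-distance construction: the distance from `z` to the
boundary of the slice of `D` by the affine subspace `z + span{v_i : i ≥ j}`. -/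
def sliceDist {n : ℕ} (D : Set (Cn n)) (z : Cn n) (v : Fin n → Cn n) (j : Fin n) : ℝ :=
  sSup {r : ℝ | 0 < r ∧
    ∀ w ∈ Submodule.span ℂ (v '' {i | j ≤ i}), ‖w‖ < r → z + w ∈ D}

/-- The data `(v j)` is an admissible output of the minimal-distance construction at `z`:
the directions are orthonormal and each `v j` realizes the distance `d_{j,D}(z)` to the
boundary of the corresponding slice. -/
def MinimalBasis {n : ℕ} (D : Set (Cn n)) (z : Cn n) (v : Fin n → Cn n) : Prop :=
  Orthonormal ℂ v ∧ ∀ j : Fin n, z + (sliceDist D z v j) • v j ∉ D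

open scoped Real Topology ENNReal

/-- The open annulus centred at the origin with radii `a` and `b`. -/
def annulus (a b : ℝ) : Set ℂ := {z | a < ‖z‖ ∧ ‖z‖ < b}

lemma isOpen_annulus (a b : ℝ) : IsOpen (annulus a b) :=
  (isOpen_lt continuous_const continuous_norm).inter (isOpen_lt continuous_norm continuous_const)

/-- Integration over an annulus in polar coordinates. -/
lemma lintegral_annulus {a b : ℝ} (ha : 0 ≤ a) (f : ℂ → ℝ≥0∞)
    (hf : Measurable ((annulus a b).indicator f)) :
    ∫⁻ z in annulus a b, f z = ∫⁻ t in Ioo a b, ∫⁻ θ in Ioo (-π) π,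
      ENNReal.ofReal t * f (t * exp (θ * I)) := by
  have hpolar : ∀ p : ℝ × ℝ, Complex.polarCoord.symm p = p.1 * exp (p.2 * I) := by
    intro p
    rw [Complex.polarCoord_symm_apply, exp_mul_I, ofReal_cos, ofReal_sin]
  have hnorm : ∀ t θ : ℝ, 0 < t → ‖(t : ℂ) * exp (θ * I)‖ = t := by
    intro t θ ht
    rw [norm_mul, norm_exp_ofReal_mul_I, mul_one, norm_real, Real.norm_of_nonneg ht.le]
  rw [← lintegral_indicator (isOpen_annulus a b).measurableSet,
    ← Complex.lintegral_comp_polarCoord_symm, polarCoord_target, Measure.volume_eq_prod,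
    ← Measure.prod_restrict, lintegral_prod, ← lintegral_indicator measurableSet_Ioi,
    ← lintegral_indicator measurableSet_Ioo]
  · refine lintegral_congr fun t => ?_
    by_cases ht : 0 < t
    · rw [indicator_of_mem (by exact ht)]
      by_cases hab : t ∈ Ioo a b
      · rw [indicator_of_mem hab]
        refine lintegral_congr fun θ => ?_
        rw [hpolar, indicator_of_mem, smul_eq_mul]
        show a < _ ∧ _ < b
        rw [hnorm t θ ht]
        exact hab
      · rw [indicator_of_notMem hab]
        refine (lintegral_congr fun θ => ?_).trans lintegral_zero
        rw [hpolar, indicator_of_notMem, smul_zero]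
        show ¬ (a < _ ∧ _ < b)
        rw [hnorm t θ ht]
        exact hab
    · rw [indicator_of_notMem (by exact ht), indicator_of_notMem]
      exact fun h => ht (ha.trans_lt h.1)
  · have : Measurable fun p : ℝ × ℝ => Complex.polarCoord.symm p := by
      simp_rw [hpolar]; fun_prop
    exact ((ENNReal.measurable_ofReal.comp measurable_fst).smul (hf.comp this)).aemeasurable

lemma lintegral_Ioo_inv {a b : ℝ} (ha : 0 < a) (hab : a ≤ b) :
    ∫⁻ t in Ioo a b, ENNReal.ofReal (2 * π * t⁻¹) = ENNReal.ofReal (2 * π * Real.log (b / a)) := by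
  have hcont : ContinuousOn (fun t : ℝ => 2 * π * t⁻¹) (Icc a b) :=
    continuousOn_const.mul (continuousOn_inv₀.mono fun t ht => (ha.trans_le ht.1).ne')
  rw [← integral_inv_of_pos ha (ha.trans_le hab), ← intervalIntegral.integral_const_mul,
    intervalIntegral.integral_of_le hab, ofReal_integral_eq_lintegral_ofReal,
    Measure.restrict_congr_set Ioo_ae_eq_Ioc]
  · exact (hcont.integrableOn_Icc).mono_set Ioc_subset_Icc_self
  · refine (ae_restrict_iff' measurableSet_Ioc).2 (Filter.Eventually.of_forall fun t ht => ?_)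
    have := ha.trans ht.1
    show 0 ≤ 2 * π * t⁻¹
    positivity

lemma measurable_indicator_annulus {a b : ℝ} {g : ℂ → ℝ} (hg : ContinuousOn g (annulus a b)) :
    Measurable ((annulus a b).indicator fun z => ENNReal.ofReal (g z)) := by
  classical
  rw [← piecewise_eq_indicator]
  exact (ENNReal.continuous_ofReal.comp_continuousOn hg).measurable_piecewise
    continuousOn_const (isOpen_annulus a b).measurableSet

/-- The logarithmic area of an annulus. -/
lemma lintegral_annulus_inv_sq {a b : ℝ} (ha : 0 < a) (hab : a ≤ b) :
    ∫⁻ z in annulus a b, ENNReal.ofReal ((‖z‖ ^ 2)⁻¹) =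
      ENNReal.ofReal (2 * π * Real.log (b / a)) := by
  rw [lintegral_annulus ha.le, ← lintegral_Ioo_inv ha hab]
  · refine setLIntegral_congr_fun measurableSet_Ioo fun t ht => ?_
    have ht0 : 0 < t := ha.trans ht.1
    simp only [norm_mul, norm_exp_ofReal_mul_I, mul_one, norm_real, Real.norm_of_nonneg ht0.le]
    rw [setLIntegral_const, Real.volume_Ioo, ← ENNReal.ofReal_mul ht0.le, ← ENNReal.ofReal_mul
      (by positivity)]
    congr 1
    field_simp
    ring
  · refine measurable_indicator_annulus (ContinuousOn.inv₀ (by fun_prop) fun z hz => ?_)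
    have := ha.trans hz.1
    positivity

/-- The square mean of a holomorphic function over a circle dominates its value at the centre. -/
lemma two_pi_le_lintegral_circle {Φ : ℂ → ℂ} (hΦ : DifferentiableOn ℂ Φ (ball 0 1))
    (h0 : Φ 0 = 1) {t : ℝ} (ht0 : 0 < t) (ht1 : t < 1) :
    ENNReal.ofReal (2 * π) ≤
      ∫⁻ θ in Ioo (-π) π, ENNReal.ofReal (‖Φ (t * exp (θ * I))‖ ^ 2) := by
  have hcb : closedBall (0 : ℂ) t ⊆ ball 0 1 := closedBall_subset_ball ht1
  have havg : Real.circleAverage (fun z => Φ z ^ 2) 0 t = 1 := by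
    rw [DiffContOnCl.circleAverage, h0, one_pow]
    rw [abs_of_pos ht0]
    refine DifferentiableOn.diffContOnCl ?_
    rw [closure_ball _ ht0.ne']
    exact (hΦ.mono hcb).pow 2
  rw [Real.circleAverage_eq_integral_add (-π)] at havg
  have hper : ∫ θ in (0 : ℝ)..2 * π, Φ (circleMap 0 t (θ + -π)) ^ 2 =
      ∫ θ in (-π)..π, Φ (t * exp (θ * I)) ^ 2 := by
    rw [intervalIntegral.integral_comp_add_right (fun θ => Φ (circleMap 0 t θ) ^ 2)]
    simp only [circleMap, zero_add]
    congr 1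
    ring
  rw [hper] at havg
  have hcont : Continuous fun θ : ℝ => Φ (t * exp (θ * I)) := by
    refine (hΦ.continuousOn).comp_continuous (by fun_prop) fun θ => ?_
    simpa [norm_exp_ofReal_mul_I, abs_of_pos ht0] using ht1
  have hle : 2 * π ≤ ∫ θ in (-π)..π, ‖Φ (t * exp (θ * I))‖ ^ 2 := by
    have h1 := intervalIntegral.norm_integral_le_integral_norm
      (f := fun θ : ℝ => Φ (t * exp (θ * I)) ^ 2) (μ := volume)
      (show -π ≤ π by linarith [Real.pi_pos])
    simp only [norm_pow] at h1
    refine le_trans ?_ h1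
    have h2 : ‖(2 * π)⁻¹ • ∫ θ in (-π)..π, Φ (t * exp (θ * I)) ^ 2‖ = 1 := by
      rw [havg, norm_one]
    rw [norm_smul, Real.norm_of_nonneg (by positivity)] at h2
    have hpi := Real.pi_pos
    rw [inv_mul_eq_one₀ (by positivity)] at h2
    exact h2.le
  rw [intervalIntegral.integral_of_le (by linarith [Real.pi_pos])] at hle
  refine (ENNReal.ofReal_le_ofReal hle).trans_eq ?_
  rw [ofReal_integral_eq_lintegral_ofReal, Measure.restrict_congr_set Ioo_ae_eq_Ioc]
  · exact ((hcont.norm.pow 2).integrableOn_Icc).mono_set Ioc_subset_Icc_self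
  · exact Filter.Eventually.of_forall fun θ => by positivity

lemma log_le_lintegral_annulus {Φ : ℂ → ℂ} (hΦ : DifferentiableOn ℂ Φ (ball 0 1))
    (h0 : Φ 0 = 1) {ρ : ℝ} (hρ0 : 0 < ρ) (hρ1 : ρ < 1) :
    ENNReal.ofReal (2 * π * Real.log (1 / ρ)) ≤
      ∫⁻ z in annulus ρ 1, ENNReal.ofReal (‖Φ z‖ ^ 2 * (‖z‖ ^ 2)⁻¹) := by
  rw [lintegral_annulus hρ0.le, ← lintegral_Ioo_inv hρ0 hρ1.le]
  · refine setLIntegral_mono' measurableSet_Ioo fun t ht => ?_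
    have ht0 : 0 < t := hρ0.trans ht.1
    simp only [norm_mul, norm_exp_ofReal_mul_I, mul_one, norm_real, Real.norm_of_nonneg ht0.le]
    have : ∀ θ : ℝ, ENNReal.ofReal t * ENNReal.ofReal (‖Φ (t * exp (θ * I))‖ ^ 2 * (t ^ 2)⁻¹) =
        ENNReal.ofReal t⁻¹ * ENNReal.ofReal (‖Φ (t * exp (θ * I))‖ ^ 2) := by
      intro θ
      rw [← ENNReal.ofReal_mul ht0.le, ← ENNReal.ofReal_mul (by positivity)]
      congr 1
      field_simp
    simp_rw [this]
    rw [lintegral_const_mul' _ _ ENNReal.ofReal_ne_top, mul_comm (2 * π),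
      ENNReal.ofReal_mul (by positivity)]
    gcongr
    exact two_pi_le_lintegral_circle hΦ h0 ht0 ht.2
  · refine measurable_indicator_annulus (ContinuousOn.mul ?_ (ContinuousOn.inv₀ (by fun_prop)
      fun z hz => ?_))
    · exact (hΦ.continuousOn.mono fun z hz => by simpa using hz.2).norm.pow 2
    · have := hρ0.trans hz.1
      positivity

lemma abs_det_smulRight_restrictScalars (a : ℂ) :
    |((ContinuousLinearMap.toSpanSingleton ℂ a).restrictScalars ℝ : ℂ →L[ℝ] ℂ).det| = ‖a‖ ^ 2 := by
  have h : ((ContinuousLinearMap.toSpanSingleton ℂ a).restrictScalars ℝ : ℂ →L[ℝ] ℂ).det =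
      Algebra.norm ℝ a := by
    rw [Algebra.norm_apply, ContinuousLinearMap.det]
    congr 1
    ext
    simp [mul_comm]
  rw [h, Algebra.norm_complex_apply, normSq_eq_norm_sq, abs_of_nonneg (by positivity)]

/-- Change of variables for the logarithmic area of the image under an injective holomorphic
function. -/
lemma lintegral_image_inv_sq {f : ℂ → ℂ} {s : Set ℂ} (hs : MeasurableSet s)
    (hf : ∀ z ∈ s, DifferentiableAt ℂ f z) (hinj : InjOn f s) :
    ∫⁻ w in f '' s, ENNReal.ofReal ((‖w‖ ^ 2)⁻¹) =
      ∫⁻ z in s, ENNReal.ofReal (‖deriv f z‖ ^ 2 * (‖f z‖ ^ 2)⁻¹) := by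
  rw [lintegral_image_eq_lintegral_abs_det_fderiv_mul volume hs (fun z hz =>
    ((hf z hz).hasDerivAt.hasFDerivAt.restrictScalars ℝ).hasFDerivWithinAt) hinj]
  refine setLIntegral_congr_fun hs fun z _ => ?_
  rw [abs_det_smulRight_restrictScalars, ← ENNReal.ofReal_mul (by positivity)]

/-- If `f` is injective and holomorphic on the unit disc, `f 0 = 0`, and `f z * f w` is never `1`,
then the image of the disc of radius `ρ` contains no disc about `0` of radius larger than `ρ`. -/
lemma radius_le_of_mul_ne_one {f : ℂ → ℂ} (hf : DifferentiableOn ℂ f (ball 0 1))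
    (hinj : InjOn f (ball 0 1)) (h0 : f 0 = 0) (hd : deriv f 0 ≠ 0)
    (hmul : ∀ z ∈ ball (0 : ℂ) 1, ∀ w ∈ ball (0 : ℂ) 1, f z * f w ≠ 1) {ρ m : ℝ} (hρ0 : 0 < ρ)
    (hρ1 : ρ < 1) (hm : 0 < m) (hsub : closedBall 0 m ⊆ f '' closedBall 0 ρ) : m ≤ ρ := by
  have hcb : closedBall (0 : ℂ) ρ ⊆ ball 0 1 := closedBall_subset_ball hρ1
  have hA : annulus ρ 1 ⊆ ball 0 1 := fun z hz => by simpa using hz.2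
  have hne : ∀ z ∈ ball (0 : ℂ) 1, z ≠ 0 → f z ≠ 0 := fun z hz hz0 hfz =>
    hz0 (hinj hz (mem_ball_self one_pos) (hfz.trans h0.symm))
  have hA0 : ∀ z ∈ annulus ρ 1, z ≠ 0 := fun z hz => norm_pos_iff.1 (hρ0.trans hz.1)
  have hdiff : ∀ z ∈ ball (0 : ℂ) 1, DifferentiableAt ℂ f z := fun z hz =>
    hf.differentiableAt (isOpen_ball.mem_nhds hz)
  have hlow : ∀ z ∈ annulus ρ 1, m < ‖f z‖ := by
    intro z hz
    by_contra! hcon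
    obtain ⟨w, hw, hwz⟩ := hsub (mem_closedBall_zero_iff.2 hcon)
    rw [hinj (hcb hw) (hA hz) hwz, mem_closedBall_zero_iff] at hw
    exact hw.not_gt hz.1
  have hupp : ∀ z ∈ annulus ρ 1, ‖f z‖ < m⁻¹ := by
    intro z hz
    by_contra! hcon
    have : ‖(f z)⁻¹‖ ≤ m := by
      rw [norm_inv]
      exact inv_le_of_inv_le₀ hm hcon
    obtain ⟨w, hw, hwz⟩ := hsub (mem_closedBall_zero_iff.2 this)
    refine hmul z (hA hz) w (hcb hw) ?_
    rw [hwz, mul_inv_cancel₀ (hne z (hA hz) (hA0 z hz))]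
  have hm1 : m < m⁻¹ := by
    obtain ⟨t, ht1, ht2⟩ := exists_between hρ1
    have ht : (t : ℂ) ∈ annulus ρ 1 := by
      show ρ < ‖(t : ℂ)‖ ∧ ‖(t : ℂ)‖ < 1
      rw [norm_real, Real.norm_of_nonneg (hρ0.trans ht1).le]
      exact ⟨ht1, ht2⟩
    exact (hlow _ ht).trans (hupp _ ht)
  have hnhds : ball (0 : ℂ) 1 ∈ 𝓝 0 := ball_mem_nhds _ one_pos
  have hslope : ∀ z ∈ ball (0 : ℂ) 1, dslope f 0 z ≠ 0 := by
    intro z hz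
    rcases eq_or_ne z 0 with rfl | hz0
    · rwa [dslope_same]
    · rw [dslope_of_ne _ hz0, slope_def_field, h0, sub_zero, sub_zero]
      exact div_ne_zero (hne z hz hz0) hz0
  have hmain := log_le_lintegral_annulus (Φ := fun z => deriv f z / dslope f 0 z)
    ((hf.deriv isOpen_ball).div ((differentiableOn_dslope hnhds).2 hf) hslope)
    (by simp [hd]) hρ0 hρ1
  have hfimg := lintegral_image_inv_sq (isOpen_annulus ρ 1).measurableSet
    (fun z hz => hdiff z (hA hz)) (hinj.mono hA)
  have hgdiff : ∀ z ∈ annulus ρ 1, DifferentiableAt ℂ (fun z => (f z)⁻¹) z := fun z hz =>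
    (hdiff z (hA hz)).inv (hne z (hA hz) (hA0 z hz))
  have hginj : InjOn (fun z => (f z)⁻¹) (annulus ρ 1) := fun z hz w hw h =>
    hinj (hA hz) (hA hw) (inv_injective h)
  have hgimg := lintegral_image_inv_sq (isOpen_annulus ρ 1).measurableSet hgdiff hginj
  have hfΦ : ∫⁻ z in annulus ρ 1, ENNReal.ofReal (‖deriv f z‖ ^ 2 * (‖f z‖ ^ 2)⁻¹) =
      ∫⁻ z in annulus ρ 1, ENNReal.ofReal (‖deriv f z / dslope f 0 z‖ ^ 2 * (‖z‖ ^ 2)⁻¹) := by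
    refine setLIntegral_congr_fun (isOpen_annulus ρ 1).measurableSet fun z hz => ?_
    have hz0 := hA0 z hz
    have hfz := hne z (hA hz) hz0
    rw [dslope_of_ne _ hz0, slope_def_field, h0, sub_zero, sub_zero, norm_div, norm_div]
    congr 1
    field_simp
  have hgf : ∫⁻ z in annulus ρ 1, ENNReal.ofReal (‖deriv (fun z => (f z)⁻¹) z‖ ^ 2 *
      (‖(f z)⁻¹‖ ^ 2)⁻¹) =
      ∫⁻ z in annulus ρ 1, ENNReal.ofReal (‖deriv f z‖ ^ 2 * (‖f z‖ ^ 2)⁻¹) := by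
    refine setLIntegral_congr_fun (isOpen_annulus ρ 1).measurableSet fun z hz => ?_
    have hfz := hne z (hA hz) (hA0 z hz)
    rw [((hdiff z (hA hz)).hasDerivAt.fun_inv hfz).deriv, norm_div, norm_neg, norm_pow, norm_inv]
    congr 1
    field_simp
  have hdisj : Disjoint (f '' annulus ρ 1) ((fun z => (f z)⁻¹) '' annulus ρ 1) := by
    rw [Set.disjoint_left]
    rintro _ ⟨z, hz, rfl⟩ ⟨w, hw, hwz⟩
    refine hmul z (hA hz) w (hA hw) ?_
    rw [← hwz]
    exact inv_mul_cancel₀ (hne w (hA hw) (hA0 w hw))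
  have hmeas : MeasurableSet ((fun z => (f z)⁻¹) '' annulus ρ 1) :=
    measurable_image_of_fderivWithin (isOpen_annulus ρ 1).measurableSet
      (fun z hz => ((hgdiff z hz).hasDerivAt.hasFDerivAt.restrictScalars ℝ).hasFDerivWithinAt) hginj
  have hunion : f '' annulus ρ 1 ∪ (fun z => (f z)⁻¹) '' annulus ρ 1 ⊆ annulus m m⁻¹ := by
    rintro _ (⟨z, hz, rfl⟩ | ⟨z, hz, rfl⟩)
    · exact ⟨hlow z hz, hupp z hz⟩
    · refine ⟨?_, ?_⟩
      · rw [norm_inv]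
        exact (lt_inv_comm₀ hm (hm.trans (hlow z hz))).2 (hupp z hz)
      · rw [norm_inv]
        exact (inv_lt_inv₀ (hm.trans (hlow z hz)) hm).2 (hlow z hz)
  have htotal := lintegral_mono_set (μ := volume) (f := fun w : ℂ => ENNReal.ofReal ((‖w‖ ^ 2)⁻¹))
    hunion
  rw [lintegral_union hmeas hdisj, hfimg, hgimg, hgf, hfΦ,
    lintegral_annulus_inv_sq hm hm1.le] at htotal
  have hfinal := (add_le_add hmain hmain).trans htotal
  have hpi := Real.pi_pos
  have hlogρ : 0 < Real.log (1 / ρ) := Real.log_pos ((one_lt_div hρ0).2 hρ1)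
  have hlogm : 0 < Real.log (m⁻¹ / m) := Real.log_pos ((one_lt_div hm).2 hm1)
  rw [← ENNReal.ofReal_add (by positivity) (by positivity),
    ENNReal.ofReal_le_ofReal_iff (by positivity), Real.log_div (inv_ne_zero hm.ne') hm.ne',
    Real.log_inv, one_div, Real.log_inv] at hfinal
  refine (Real.log_le_log_iff hm hρ0).1 ?_
  nlinarith

/-- An injective holomorphic function maps a closed disc onto a set containing the disc whose
radius is the minimum of the modulus on the boundary circle. -/
lemma closedBall_subset_image_closedBall {f : ℂ → ℂ} (hf : DifferentiableOn ℂ f (ball 0 1))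
    (hinj : InjOn f (ball 0 1)) (h0 : f 0 = 0) {ρ m : ℝ} (hρ0 : 0 < ρ) (hρ1 : ρ < 1) (hm : 0 < m)
    (hmin : ∀ z, ‖z‖ = ρ → m < ‖f z‖) : closedBall 0 m ⊆ f '' closedBall 0 ρ := by
  have hcb : closedBall (0 : ℂ) ρ ⊆ ball 0 1 := closedBall_subset_ball hρ1
  have hopen : IsOpen (f '' ball 0 ρ) := by
    have han : AnalyticOnNhd ℂ f (ball 0 1) := hf.analyticOnNhd isOpen_ball
    rcases han.is_constant_or_isOpen (convex_ball 0 1).isPreconnected with ⟨w, hw⟩ | h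
    · have h2 : ((ρ : ℝ) : ℂ) ∈ ball (0 : ℂ) 1 := by
        simpa [abs_of_pos hρ0] using hρ1
      have := hinj h2 (mem_ball_self one_pos) ((hw _ h2).trans (hw _ (mem_ball_self one_pos)).symm)
      exact absurd this (by exact_mod_cast hρ0.ne')
    · exact h _ (ball_subset_ball hρ1.le) isOpen_ball
  have hclosed : IsClosed (f '' closedBall 0 ρ) :=
    ((isCompact_closedBall 0 ρ).image_of_continuousOn (hf.continuousOn.mono hcb)).isClosed
  have hconn : IsPreconnected (closedBall (0 : ℂ) m) := (convex_closedBall 0 m).isPreconnected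
  by_contra hnot
  obtain ⟨w, hw, hwn⟩ := not_subset.1 hnot
  obtain ⟨y, hy, ⟨z, hz, rfl⟩, hyn⟩ := hconn (f '' ball 0 ρ) (f '' closedBall 0 ρ)ᶜ hopen
    hclosed.isOpen_compl (fun y hy => by
      by_cases hy' : y ∈ f '' closedBall 0 ρ
      · left
        obtain ⟨z, hz, rfl⟩ := hy'
        refine ⟨z, ?_, rfl⟩
        rw [mem_ball_zero_iff]
        refine lt_of_le_of_ne (mem_closedBall_zero_iff.1 hz) fun h => ?_
        exact (hmin z h).not_ge (mem_closedBall_zero_iff.1 hy)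
      · exact Or.inr hy')
    ⟨0, mem_closedBall_self hm.le, 0, mem_ball_self hρ0, h0⟩ ⟨w, hw, hwn⟩
  exact hyn ⟨z, ball_subset_closedBall hz, rfl⟩

/-- The Bieberbach–Eilenberg inequality for injective functions. -/
lemma norm_deriv_le_one_of_mul_ne_one {f : ℂ → ℂ} (hf : DifferentiableOn ℂ f (ball 0 1))
    (hinj : InjOn f (ball 0 1)) (h0 : f 0 = 0)
    (hmul : ∀ z ∈ ball (0 : ℂ) 1, ∀ w ∈ ball (0 : ℂ) 1, f z * f w ≠ 1) : ‖deriv f 0‖ ≤ 1 := by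
  by_contra! hcon
  obtain ⟨K, hK1, hK⟩ := exists_between hcon
  have hd : HasDerivAt f (deriv f 0) 0 :=
    (hf.differentiableAt (ball_mem_nhds _ one_pos)).hasDerivAt
  have hev : ∀ᶠ z in 𝓝[≠] (0 : ℂ), K < ‖slope f 0 z‖ :=
    (hasDerivAt_iff_tendsto_slope.1 hd).norm.eventually_const_lt hK
  rw [eventually_nhdsWithin_iff, Metric.eventually_nhds_iff] at hev
  obtain ⟨ε, hε, hev⟩ := hev
  obtain ⟨ρ, hρ0, hρ⟩ := exists_between (lt_min hε one_pos)
  have hρε := hρ.trans_le (min_le_left _ _)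
  have hρ1 := hρ.trans_le (min_le_right _ _)
  have := radius_le_of_mul_ne_one hf hinj h0 (norm_pos_iff.1 (one_pos.trans hcon)) hmul hρ0 hρ1
    (m := K * ρ) (by positivity) (closedBall_subset_image_closedBall hf hinj h0 hρ0 hρ1
      (by positivity) fun z hz => by
        have hz0 : z ≠ 0 := norm_pos_iff.1 (hz ▸ hρ0)
        have := hev (y := z) (by rwa [dist_zero_right, hz]) hz0
        rwa [slope_def_field, h0, sub_zero, sub_zero, norm_div, hz, lt_div_iff₀ hρ0] at this)
  nlinarith

/-- A continuous logarithm is locally given by the principal branch. -/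
lemma eventually_eq_add_log {α : Type*} [TopologicalSpace α] {L h : α → ℂ} {U : Set α} {x : α}
    (hU : U ∈ 𝓝 x) (hL : ContinuousAt L x) (hexp : ∀ y ∈ U, exp (L y) = h y) :
    ∀ᶠ y in 𝓝 x, L y = L x + log (h y / h x) := by
  have him : ContinuousAt (fun y => (L y - L x).im) x :=
    continuous_im.continuousAt.comp (hL.sub continuousAt_const)
  have h1 : ∀ᶠ y in 𝓝 x, -π < (L y - L x).im :=
    him.eventually_const_lt (by simpa using Real.pi_pos)
  have h2 : ∀ᶠ y in 𝓝 x, (L y - L x).im < π :=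
    him.eventually_lt_const (by simpa using Real.pi_pos)
  filter_upwards [hU, h1, h2] with y hy hy1 hy2
  rw [← hexp y hy, ← hexp x (mem_of_mem_nhds hU), ← exp_sub, log_exp hy1 hy2.le]
  ring

/-- A continuous logarithm of a holomorphic function is holomorphic. -/
lemma differentiableOn_of_exp_eq {L h : ℂ → ℂ} {U : Set ℂ} (hU : IsOpen U)
    (hL : ContinuousOn L U) (hh : DifferentiableOn ℂ h U) (hexp : ∀ z ∈ U, exp (L z) = h z) :
    DifferentiableOn ℂ L U := by
  intro z hz
  have hUz := hU.mem_nhds hz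
  have hd := hh.differentiableAt hUz
  have h0 : h z ≠ 0 := hexp z hz ▸ exp_ne_zero _
  refine DifferentiableAt.differentiableWithinAt ?_
  refine DifferentiableAt.congr_of_eventuallyEq ?_
    (eventually_eq_add_log hUz (hL.continuousAt hUz) hexp)
  exact ((hd.div_const _).clog (by simp [div_self h0])).const_add _

/-- Every holomorphic nonvanishing function on `G` has a holomorphic logarithm. -/
def HasLog (G : Set ℂ) : Prop :=
  ∀ h : ℂ → ℂ, DifferentiableOn ℂ h G → (∀ z ∈ G, h z ≠ 0) →
    ∃ L : ℂ → ℂ, DifferentiableOn ℂ L G ∧ ∀ z ∈ G, exp (L z) = h z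

lemma isSimplyConnected_of_convex {E : Type*} [NormedAddCommGroup E] [NormedSpace ℝ E] {s : Set E}
    (hs : Convex ℝ s) (hne : s.Nonempty) : IsSimplyConnected s := by
  have := hs.contractibleSpace hne
  show SimplyConnectedSpace s
  infer_instance

lemma hasLog_ball (c : ℂ) {r : ℝ} (hr : 0 < r) : HasLog (ball c r) := by
  intro h hh h0
  obtain ⟨L, hL, hexp⟩ := exists_continuousOn_eqOn_exp_comp
    (isSimplyConnected_of_convex (convex_ball c r) ⟨c, mem_ball_self hr⟩) isOpen_ball
    hh.continuousOn (by rintro ⟨z, hz, hz0⟩; exact h0 z hz hz0)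
  exact ⟨L, differentiableOn_of_exp_eq isOpen_ball hL hh hexp, hexp⟩

/-- The Koebe distortion estimate for injective nonvanishing functions. -/
lemma norm_deriv_le_four_mul {f : ℂ → ℂ} (hf : DifferentiableOn ℂ f (ball 0 1))
    (hinj : InjOn f (ball 0 1)) (h0 : ∀ z ∈ ball (0 : ℂ) 1, f z ≠ 0) :
    ‖deriv f 0‖ ≤ 4 * ‖f 0‖ := by
  obtain ⟨L, hL, hexp⟩ := hasLog_ball 0 one_pos f hf h0
  have h0m : (0 : ℂ) ∈ ball (0 : ℂ) 1 := mem_ball_self one_pos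
  set g : ℂ → ℂ := fun z => exp (L z / 2) with hg
  have hg2 : ∀ z ∈ ball (0 : ℂ) 1, g z ^ 2 = f z := fun z hz => by
    rw [hg, ← hexp z hz]
    simp only
    rw [← exp_nat_mul]
    congr 1
    push_cast
    ring
  have hg0 : ∀ z, g z ≠ 0 := fun z => exp_ne_zero _
  have hgdiff : DifferentiableOn ℂ g (ball 0 1) := (hL.div_const 2).cexp
  have hginj : InjOn g (ball 0 1) := fun z hz w hw h =>
    hinj hz hw (by rw [← hg2 z hz, ← hg2 w hw, h])
  have hsum : ∀ z ∈ ball (0 : ℂ) 1, ∀ w ∈ ball (0 : ℂ) 1, g z + g w ≠ 0 := by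
    intro z hz w hw h
    have hzw : g z = -g w := eq_neg_of_add_eq_zero_left h
    have := hinj hz hw (by rw [← hg2 z hz, ← hg2 w hw, hzw, neg_sq])
    subst this
    exact hg0 z (by linear_combination h / 2)
  have hB := norm_deriv_le_one_of_mul_ne_one (f := fun z => (g z - g 0) / (g z + g 0))
    ((hgdiff.sub_const _).div (hgdiff.add_const _) fun z hz => hsum z hz 0 h0m)
    (fun z hz w hw h => by
      simp only at h
      rw [div_eq_div_iff (hsum z hz 0 h0m) (hsum w hw 0 h0m)] at h
      refine hginj hz hw ?_
      have : (2 * g 0) * (g z - g w) = 0 := by linear_combination h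
      exact sub_eq_zero.1 ((mul_eq_zero.1 this).resolve_left (mul_ne_zero two_ne_zero (hg0 0))))
    (by simp) (fun z hz w hw h => by
      rw [div_mul_div_comm, div_eq_one_iff_eq
        (mul_ne_zero (hsum z hz 0 h0m) (hsum w hw 0 h0m))] at h
      have : (2 * g 0) * (g z + g w) = 0 := by linear_combination -h
      exact (mul_ne_zero (mul_ne_zero two_ne_zero (hg0 0)) (hsum z hz w hw)) this)
  have hnhds : ball (0 : ℂ) 1 ∈ 𝓝 0 := ball_mem_nhds _ one_pos
  have hLd := (hL.differentiableAt hnhds).hasDerivAt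
  have hgd : HasDerivAt g (g 0 * (deriv L 0 / 2)) 0 := (hLd.div_const 2).cexp
  have hfd : HasDerivAt f (f 0 * deriv L 0) 0 := by
    have := hLd.cexp
    rw [hexp 0 h0m] at this
    refine this.congr_of_eventuallyEq ?_
    filter_upwards [hnhds] with z hz using (hexp z hz).symm
  have hBd := ((hgd.sub_const (g 0)).fun_div (hgd.add_const (g 0)) (hsum 0 h0m 0 h0m)).deriv
  rw [hBd, sub_self, zero_mul, sub_zero, ← two_mul] at hB
  have : g 0 * (deriv L 0 / 2) * (2 * g 0) / (2 * g 0) ^ 2 = deriv L 0 / 4 := by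
    have := hg0 0
    field_simp
    ring
  rw [this, norm_div] at hB
  rw [hfd.deriv, norm_mul]
  have h4 : ‖(4 : ℂ)‖ = 4 := by norm_num
  rw [h4, div_le_one (by norm_num)] at hB
  nlinarith [norm_nonneg (f 0)]

/-- The automorphism of the unit disc sending `w` to `0`. -/
def discMob (w ζ : ℂ) : ℂ := (ζ - w) / (1 - starRingEnd ℂ w * ζ)

lemma discMob_denom_ne_zero {w ζ : ℂ} (hw : ‖w‖ < 1) (hζ : ‖ζ‖ < 1) :
    1 - starRingEnd ℂ w * ζ ≠ 0 := by
  intro h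
  have h1 : ‖starRingEnd ℂ w * ζ‖ = 1 := by rw [← sub_eq_zero.1 h, norm_one]
  rw [norm_mul, norm_conj] at h1
  nlinarith [norm_nonneg w, norm_nonneg ζ]

lemma discMob_self (w : ℂ) : discMob w w = 0 := by simp [discMob]

lemma discMob_zero (w : ℂ) : discMob w 0 = -w := by simp [discMob]

lemma discMob_eq_zero {w ζ : ℂ} (hw : ‖w‖ < 1) (hζ : ‖ζ‖ < 1) (h : discMob w ζ = 0) : ζ = w :=
  sub_eq_zero.1 ((div_eq_zero_iff.1 h).resolve_right (discMob_denom_ne_zero hw hζ))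

lemma norm_discMob_lt_one {w ζ : ℂ} (hw : ‖w‖ < 1) (hζ : ‖ζ‖ < 1) : ‖discMob w ζ‖ < 1 := by
  have hne := discMob_denom_ne_zero hw hζ
  rw [discMob, norm_div, div_lt_one (norm_pos_iff.2 hne)]
  refine lt_of_pow_lt_pow_left₀ 2 (norm_nonneg _) ?_
  have key : ‖1 - starRingEnd ℂ w * ζ‖ ^ 2 - ‖ζ - w‖ ^ 2 = (1 - ‖w‖ ^ 2) * (1 - ‖ζ‖ ^ 2) := by
    simp only [← normSq_eq_norm_sq, normSq_apply, sub_re, sub_im, mul_re, mul_im, one_re, one_im,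
      conj_re, conj_im]
    ring
  have h1 : ‖w‖ ^ 2 < 1 := by nlinarith [norm_nonneg w]
  have h2 : ‖ζ‖ ^ 2 < 1 := by nlinarith [norm_nonneg ζ]
  nlinarith [mul_pos (sub_pos.2 h1) (sub_pos.2 h2)]

lemma one_sub_conj_mul_self (w : ℂ) : 1 - starRingEnd ℂ w * w = ((1 - ‖w‖ ^ 2 : ℝ) : ℂ) := by
  rw [mul_comm, mul_conj, normSq_eq_norm_sq]
  push_cast
  rfl

lemma one_sub_norm_sq_ne_zero {w : ℂ} (hw : ‖w‖ < 1) : ((1 - ‖w‖ ^ 2 : ℝ) : ℂ) ≠ 0 := by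
  have : ‖w‖ ^ 2 < 1 := by nlinarith [norm_nonneg w]
  exact_mod_cast (sub_pos.2 this).ne'

lemma discMob_inj {w ζ ξ : ℂ} (hw : ‖w‖ < 1) (hζ : ‖ζ‖ < 1) (hξ : ‖ξ‖ < 1)
    (h : discMob w ζ = discMob w ξ) : ζ = ξ := by
  rw [discMob, discMob, div_eq_div_iff (discMob_denom_ne_zero hw hζ)
    (discMob_denom_ne_zero hw hξ)] at h
  have : (1 - starRingEnd ℂ w * w) * (ζ - ξ) = 0 := by linear_combination h
  rw [one_sub_conj_mul_self] at this
  exact sub_eq_zero.1 ((mul_eq_zero.1 this).resolve_left (one_sub_norm_sq_ne_zero hw))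

lemma hasDerivAt_discMob {w ζ : ℂ} (hw : ‖w‖ < 1) (hζ : ‖ζ‖ < 1) :
    HasDerivAt (discMob w) (((1 - ‖w‖ ^ 2 : ℝ) : ℂ) / (1 - starRingEnd ℂ w * ζ) ^ 2) ζ := by
  have h := ((hasDerivAt_id ζ).sub_const w).fun_div
    (((hasDerivAt_id ζ).const_mul (starRingEnd ℂ w)).const_sub 1) (discMob_denom_ne_zero hw hζ)
  refine h.congr_deriv ?_
  rw [← one_sub_conj_mul_self]
  simp only [id]
  ring

/-- Injective holomorphic functions from `G` to the unit disc. -/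
structure IsSchlicht (G : Set ℂ) (F : ℂ → ℂ) : Prop where
  diff : DifferentiableOn ℂ F G
  mapsTo : MapsTo F G (ball 0 1)
  inj : InjOn F G
  deriv_ne : ∀ z ∈ G, deriv F z ≠ 0

lemma IsSchlicht.norm_lt {G : Set ℂ} {F : ℂ → ℂ} (hF : IsSchlicht G F) {z : ℂ} (hz : z ∈ G) :
    ‖F z‖ < 1 := by
  simpa using hF.mapsTo hz

lemma IsSchlicht.hasDerivAt {G : Set ℂ} {F : ℂ → ℂ} (hG : IsOpen G) (hF : IsSchlicht G F) {z : ℂ}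
    (hz : z ∈ G) : HasDerivAt F (deriv F z) z :=
  (hF.diff.differentiableAt (hG.mem_nhds hz)).hasDerivAt

lemma IsSchlicht.hasDerivAt_discMob_comp {G : Set ℂ} {F : ℂ → ℂ} (hG : IsOpen G)
    (hF : IsSchlicht G F) {w : ℂ} (hw : ‖w‖ < 1) {z : ℂ} (hz : z ∈ G) :
    HasDerivAt (discMob w ∘ F)
      (((1 - ‖w‖ ^ 2 : ℝ) : ℂ) / (1 - starRingEnd ℂ w * F z) ^ 2 * deriv F z) z :=
  (hasDerivAt_discMob hw (hF.norm_lt hz)).comp z (hF.hasDerivAt hG hz)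

lemma IsSchlicht.discMob_comp {G : Set ℂ} {F : ℂ → ℂ} (hG : IsOpen G) (hF : IsSchlicht G F)
    {w : ℂ} (hw : ‖w‖ < 1) : IsSchlicht G (discMob w ∘ F) where
  diff z hz := (hF.hasDerivAt_discMob_comp hG hw hz).differentiableAt.differentiableWithinAt
  mapsTo z hz := by simpa using norm_discMob_lt_one hw (hF.norm_lt hz)
  inj z hz z' hz' h := hF.inj hz hz' (discMob_inj hw (hF.norm_lt hz) (hF.norm_lt hz') h)
  deriv_ne z hz := by
    rw [(hF.hasDerivAt_discMob_comp hG hw hz).deriv]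
    exact mul_ne_zero (div_ne_zero (one_sub_norm_sq_ne_zero hw)
      (pow_ne_zero 2 (discMob_denom_ne_zero hw (hF.norm_lt hz)))) (hF.deriv_ne z hz)

lemma HasLog.exists_sqrt {G : Set ℂ} (hG : IsOpen G) (hlog : HasLog G) {h : ℂ → ℂ}
    (hh : DifferentiableOn ℂ h G) (h0 : ∀ z ∈ G, h z ≠ 0) :
    ∃ k : ℂ → ℂ, (∀ z ∈ G, k z ^ 2 = h z) ∧
      ∀ z ∈ G, HasDerivAt k (deriv h z / (2 * k z)) z := by
  obtain ⟨L, hL, hexp⟩ := hlog h hh h0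
  refine ⟨fun z => exp (L z / 2), fun z hz => ?_, fun z hz => ?_⟩
  · rw [← hexp z hz, ← exp_nat_mul]
    congr 1
    push_cast
    ring
  · have hLd := (hL.differentiableAt (hG.mem_nhds hz)).hasDerivAt
    have hd : HasDerivAt h (exp (L z) * deriv L z) z :=
      hLd.cexp.congr_of_eventuallyEq (by
        filter_upwards [hG.mem_nhds hz] with w hw using (hexp w hw).symm)
    refine (hLd.div_const 2).cexp.congr_deriv ?_
    have h2 : exp (L z) = exp (L z / 2) * exp (L z / 2) := by
      rw [← exp_add]
      congr 1
      ring
    rw [hd.deriv, h2]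
    have := exp_ne_zero (L z / 2)
    field_simp

lemma exists_isSchlicht {G : Set ℂ} (hG : IsOpen G) (hlog : HasLog G) (h0 : (0 : ℂ) ∉ G) {c : ℂ}
    (hc : c ∈ G) : ∃ F, IsSchlicht G F ∧ F c = 0 := by
  obtain ⟨g, hg2, hgd⟩ := hlog.exists_sqrt hG differentiableOn_id
    (fun z hz (h : z = 0) => h0 (h ▸ hz))
  simp only [id, deriv_id'] at hg2 hgd
  have hg0 : ∀ z ∈ G, g z ≠ 0 := fun z hz h => h0 (by
    have := hg2 z hz
    rw [h, zero_pow two_ne_zero] at this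
    exact this ▸ hz)
  have hd0 : ∀ z ∈ G, 1 / (2 * g z) ≠ 0 := fun z hz =>
    one_div_ne_zero (mul_ne_zero two_ne_zero (hg0 z hz))
  have hgdiff : DifferentiableOn ℂ g G := fun z hz =>
    (hgd z hz).differentiableAt.differentiableWithinAt
  have hst : HasStrictDerivAt g (1 / (2 * g c)) c := by
    have := (hgdiff.analyticAt (hG.mem_nhds hc)).hasStrictDerivAt
    rwa [(hgd c hc).deriv] at this
  have himg : g '' G ∈ 𝓝 (g c) := by
    rw [← hst.map_nhds_eq (hd0 c hc)]
    exact Filter.image_mem_map (hG.mem_nhds hc)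
  obtain ⟨ρ, hρ, hball⟩ := Metric.mem_nhds_iff.1 himg
  have hfar : ∀ z ∈ G, ρ ≤ ‖g z + g c‖ := by
    intro z hz
    by_contra! hlt
    obtain ⟨w, hw, hwz⟩ := hball (show -g z ∈ ball (g c) ρ by
      rwa [mem_ball, dist_eq_norm, ← norm_neg, neg_sub, sub_neg_eq_add, add_comm])
    have : w = z := by rw [← hg2 w hw, ← hg2 z hz, hwz, neg_sq]
    subst this
    exact hg0 w hw (by linear_combination hwz / 2)
  have hne : ∀ z ∈ G, g z + g c ≠ 0 := fun z hz => norm_pos_iff.1 (hρ.trans_le (hfar z hz))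
  have hρ2 : ((ρ / 2 : ℝ) : ℂ) ≠ 0 := by exact_mod_cast (half_pos hρ).ne'
  have hFd : ∀ z ∈ G, HasDerivAt (fun z => ((ρ / 2 : ℝ) : ℂ) / (g z + g c))
      (-(((ρ / 2 : ℝ) : ℂ) * (1 / (2 * g z))) / (g z + g c) ^ 2) z := fun z hz => by
    refine ((hasDerivAt_const z ((ρ / 2 : ℝ) : ℂ)).fun_div ((hgd z hz).add_const (g c))
      (hne z hz)).congr_deriv ?_
    ring
  have hF : IsSchlicht G (fun z => ((ρ / 2 : ℝ) : ℂ) / (g z + g c)) :=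
    { diff := fun z hz => (hFd z hz).differentiableAt.differentiableWithinAt
      mapsTo := fun z hz => by
        rw [mem_ball_zero_iff, norm_div, norm_real, Real.norm_of_nonneg (half_pos hρ).le,
          div_lt_one (norm_pos_iff.2 (hne z hz))]
        exact (half_lt_self hρ).trans_le (hfar z hz)
      inj := fun z hz w hw h => by
        simp only at h
        rw [div_eq_div_iff (hne z hz) (hne w hw)] at h
        have : g z = g w := by
          have := mul_left_cancel₀ hρ2 h
          linear_combination -this
        rw [← hg2 z hz, ← hg2 w hw, this]
      deriv_ne := fun z hz => by
        rw [(hFd z hz).deriv]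
        exact div_ne_zero (neg_ne_zero.2 (mul_ne_zero hρ2 (hd0 z hz))) (pow_ne_zero 2 (hne z hz)) }
  exact ⟨_, hF.discMob_comp hG (hF.norm_lt hc), discMob_self _⟩

/-- Koebe's square root trick. -/
lemma IsSchlicht.exists_larger_deriv {G : Set ℂ} (hG : IsOpen G) (hlog : HasLog G) {c : ℂ}
    (hc : c ∈ G) {F : ℂ → ℂ} (hF : IsSchlicht G F) (hFc : F c = 0) {w : ℂ} (hw : ‖w‖ < 1)
    (hwF : w ∉ F '' G) : ∃ F₁, IsSchlicht G F₁ ∧ F₁ c = 0 ∧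
      2 * √‖w‖ * ‖deriv F₁ c‖ = (1 + ‖w‖) * ‖deriv F c‖ := by
  have hw0 : w ≠ 0 := fun h => hwF (h ▸ ⟨c, hc, hFc⟩)
  have hh := hF.discMob_comp hG hw
  have hh0 : ∀ z ∈ G, (discMob w ∘ F) z ≠ 0 := fun z hz h =>
    hwF ⟨z, hz, discMob_eq_zero hw (hF.norm_lt hz) h⟩
  obtain ⟨k, hk2, hkd⟩ := hlog.exists_sqrt hG hh.diff hh0
  have hk0 : ∀ z ∈ G, k z ≠ 0 := fun z hz h => hh0 z hz (by rw [← hk2 z hz, h]; ring)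
  have hk : IsSchlicht G k :=
    { diff := fun z hz => (hkd z hz).differentiableAt.differentiableWithinAt
      mapsTo := fun z hz => by
        have := hh.norm_lt hz
        rw [← hk2 z hz, norm_pow] at this
        rw [mem_ball_zero_iff]
        nlinarith
      inj := fun z hz z' hz' h => hh.inj hz hz' (by rw [← hk2 z hz, ← hk2 z' hz', h])
      deriv_ne := fun z hz => by
        rw [(hkd z hz).deriv]
        exact div_ne_zero (hh.deriv_ne z hz) (mul_ne_zero two_ne_zero (hk0 z hz)) }
  have hkc := hk.norm_lt hc
  refine ⟨_, hk.discMob_comp hG hkc, discMob_self _, ?_⟩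
  have hkn : ‖k c‖ ^ 2 = ‖w‖ := by
    rw [← norm_pow, hk2 c hc, Function.comp_apply, hFc, discMob_zero, norm_neg]
  have hkn' : √‖w‖ = ‖k c‖ := by rw [← hkn, Real.sqrt_sq (norm_nonneg _)]
  rw [(hk.hasDerivAt_discMob_comp hG hkc hc).deriv, (hkd c hc).deriv,
    (hF.hasDerivAt_discMob_comp hG hw hc).deriv, hFc, one_sub_conj_mul_self, hkn', hkn]
  simp only [mul_zero, sub_zero, one_pow, div_one, norm_mul, norm_div, norm_pow, norm_real,
    Real.norm_eq_abs, norm_ofNat]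
  rw [abs_of_pos (show 0 < 1 - ‖w‖ by linarith),
    abs_of_pos (show 0 < 1 - ‖w‖ ^ 2 by nlinarith [norm_nonneg w])]
  have h1 : 1 - ‖w‖ ≠ 0 := (sub_pos.2 hw).ne'
  have h2 : ‖k c‖ ≠ 0 := norm_ne_zero_iff.2 (hk0 c hc)
  field_simp
  ring

/-- On an open set `G` omitting the origin on which holomorphic logarithms exist, the Carathéodory
metric at `c` is at least `1 / (4 ‖c‖)`. -/
theorem exists_norm_deriv_ge {G : Set ℂ} (hG : IsOpen G) (hlog : HasLog G) (h0 : (0 : ℂ) ∉ G)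
    {c : ℂ} (hc : c ∈ G) {t : ℝ} (ht0 : 0 < t) (ht1 : t < 1) :
    ∃ F : ℂ → ℂ, DifferentiableOn ℂ F G ∧ MapsTo F G (ball 0 1) ∧ F c = 0 ∧
      t ≤ 4 * ‖c‖ * ‖deriv F c‖ := by
  set S : Set ℝ := {x | ∃ F, IsSchlicht G F ∧ F c = 0 ∧ x = ‖deriv F c‖} with hS
  obtain ⟨r, hr, hball⟩ := Metric.isOpen_iff.1 hG c hc
  have hbdd : BddAbove S := by
    refine ⟨1 / r, ?_⟩
    rintro _ ⟨F, hF, hFc, rfl⟩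
    refine norm_deriv_le_div_of_mapsTo_ball (hF.diff.mono hball) (fun z hz => ?_) hr
    rw [hFc]
    exact ball_subset_closedBall (hF.mapsTo (hball hz))
  obtain ⟨F₀, hF₀, hF₀c⟩ := exists_isSchlicht hG hlog h0 hc
  have hspos : 0 < sSup S := (norm_pos_iff.2 (hF₀.deriv_ne c hc)).trans_le
    (le_csSup hbdd ⟨F₀, hF₀, hF₀c, rfl⟩)
  have hst : 0 < √t := Real.sqrt_pos.2 ht0
  have hst1 : √t < 1 := by rw [Real.sqrt_lt' one_pos]; simpa using ht1
  have hsq : √t ^ 2 = t := Real.sq_sqrt ht0.le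
  obtain ⟨_, ⟨F, hF, hFc, rfl⟩, hlt⟩ := exists_lt_of_lt_csSup (s := S)
    (b := 2 * √t / (1 + t) * sSup S) ⟨_, F₀, hF₀, hF₀c, rfl⟩ (by
      refine mul_lt_of_lt_one_left hspos ?_
      rw [div_lt_one (by linarith)]
      nlinarith)
  refine ⟨F, hF.diff, hF.mapsTo, hFc, ?_⟩
  have hsub : ∀ w ∈ ball (0 : ℂ) t, w ∈ F '' G := by
    intro w hw
    by_contra hwF
    rw [mem_ball_zero_iff] at hw
    obtain ⟨F₁, hF₁, hF₁c, heq⟩ := hF.exists_larger_deriv hG hlog hc hFc (hw.trans ht1) hwF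
    have hle : ‖deriv F₁ c‖ ≤ sSup S := le_csSup hbdd ⟨F₁, hF₁, hF₁c, rfl⟩
    have hsw : √‖w‖ ^ 2 = ‖w‖ := Real.sq_sqrt (norm_nonneg _)
    have hswt : √‖w‖ < √t := Real.sqrt_lt_sqrt (norm_nonneg _) hw
    have hsw0 : 0 ≤ √‖w‖ := Real.sqrt_nonneg _
    rw [div_mul_eq_mul_div, div_lt_iff₀ (by linarith)] at hlt
    have hd : 0 < ‖deriv F c‖ := norm_pos_iff.2 (hF.deriv_ne c hc)
    have hcmp : √‖w‖ * (1 + √t ^ 2) ≤ √t * (1 + √‖w‖ ^ 2) := by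
      nlinarith [mul_nonneg (sub_nonneg.2 hswt.le) (sub_nonneg.2
        (show √‖w‖ * √t ≤ 1 by nlinarith))]
    rw [hsq, hsw] at hcmp
    have h1 : 2 * √t * (2 * √‖w‖ * ‖deriv F₁ c‖) ≤ 2 * √‖w‖ * (2 * √t * sSup S) := by
      nlinarith [mul_nonneg hst.le hsw0]
    have h2 : 2 * √‖w‖ * (2 * √t * sSup S) ≤ 2 * √‖w‖ * (‖deriv F c‖ * (1 + t)) :=
      mul_le_mul_of_nonneg_left hlt.le (by positivity)
    rcases hsw0.eq_or_lt with h | h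
    · have hw0 : ‖w‖ = 0 := by rw [← hsw, ← h]; ring
      exact hwF ⟨c, hc, by rw [hFc, norm_eq_zero.1 hw0]⟩
    · have h3 : 2 * √‖w‖ * (2 * √t * sSup S) < 2 * √‖w‖ * (‖deriv F c‖ * (1 + t)) :=
        mul_lt_mul_of_pos_left hlt (by positivity)
      rw [heq] at h1
      nlinarith
  choose! inv hinvG hinvF using hsub
  replace hinvG : ∀ {w}, w ∈ ball (0 : ℂ) t → inv w ∈ G := fun h => hinvG _ h
  replace hinvF : ∀ {w}, w ∈ ball (0 : ℂ) t → F (inv w) = w := fun h => hinvF _ h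
  have hinv0 : inv 0 = c :=
    hF.inj (hinvG (mem_ball_self ht0)) hc (by rw [hinvF (mem_ball_self ht0), hFc])
  have hinvd : ∀ y ∈ ball (0 : ℂ) t, HasDerivAt inv (deriv F (inv y))⁻¹ y := by
    intro y hy
    have hx := hinvG hy
    have hst := (hF.diff.analyticAt (hG.mem_nhds hx)).hasStrictDerivAt
    have hFx : F (inv y) = y := hinvF hy
    have hcont : F ⁻¹' ball 0 t ∈ 𝓝 (inv y) :=
      hst.hasDerivAt.continuousAt (isOpen_ball.mem_nhds (by rwa [hFx]))
    have := (hst.to_local_left_inverse (hF.deriv_ne _ hx) (g := inv) (by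
      filter_upwards [hG.mem_nhds hx, hcont] with z hz hz'
      exact hF.inj (hinvG hz') hz (hinvF hz'))).hasDerivAt
    rwa [hFx] at this
  have hscale : ∀ ζ ∈ ball (0 : ℂ) 1, (t : ℂ) * ζ ∈ ball (0 : ℂ) t := by
    intro ζ hζ
    rw [mem_ball_zero_iff] at hζ ⊢
    rw [norm_mul, norm_real, Real.norm_of_nonneg ht0.le]
    nlinarith
  have htc : (t : ℂ) ≠ 0 := by exact_mod_cast ht0.ne'
  have hcd : ∀ ζ ∈ ball (0 : ℂ) 1, HasDerivAt (fun ζ => inv (t * ζ))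
      ((deriv F (inv (t * ζ)))⁻¹ * t) ζ := fun ζ hζ => by
    have := (hinvd _ (hscale ζ hζ)).comp ζ ((hasDerivAt_id ζ).const_mul (t : ℂ))
    simpa [Function.comp_def] using this
  have hK := norm_deriv_le_four_mul (f := fun ζ => inv (t * ζ))
    (fun ζ hζ => (hcd ζ hζ).differentiableAt.differentiableWithinAt)
    (fun ζ hζ ξ hξ h => by
      have := congrArg F h
      simp only at this
      rw [hinvF (hscale ζ hζ), hinvF (hscale ξ hξ)] at this
      exact mul_left_cancel₀ htc this)
    (fun ζ hζ h => h0 (h ▸ hinvG (hscale ζ hζ)))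
  rw [(hcd 0 (mem_ball_self one_pos)).deriv, mul_zero, hinv0, norm_mul, norm_inv, norm_real,
    Real.norm_of_nonneg ht0.le, inv_mul_eq_div, div_le_iff₀
    (norm_pos_iff.2 (hF.deriv_ne c hc))] at hK
  exact hK

lemma isLocallyInjective_exp : IsLocallyInjective exp := by
  intro x
  refine ⟨{y | |(y - x).im| < π}, isOpen_lt (by fun_prop) continuous_const,
    by simpa using Real.pi_pos, fun y hy z hz h => ?_⟩
  have hy' := abs_lt.1 (mem_ofPred.1 hy)
  have hz' := abs_lt.1 (mem_ofPred.1 hz)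
  refine sub_left_inj.1 (exp_inj_of_neg_pi_lt_of_le_pi hy'.1 hy'.2.le hz'.1 hz'.2.le ?_)
  rw [exp_sub, exp_sub, h]

/-- The increment of a continuous logarithm over a preconnected set is unique. -/
lemma sub_eq_sub_of_exp_eq {α : Type*} [TopologicalSpace α] {S : Set α} (hS : IsPreconnected S)
    {L₁ L₂ : α → ℂ} (h₁ : ContinuousOn L₁ S) (h₂ : ContinuousOn L₂ S)
    (hexp : ∀ x ∈ S, exp (L₁ x) = exp (L₂ x)) {x y : α} (hx : x ∈ S) (hy : y ∈ S) :
    L₁ x - L₁ y = L₂ x - L₂ y := by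
  have hk : exp (L₁ y - L₂ y) = 1 := by rw [exp_sub, hexp y hy, div_self (exp_ne_zero _)]
  have := (T2Space.isSeparatedMap exp).eqOn_of_comp_eqOn isLocallyInjective_exp hS h₁
    (g₂ := fun z => L₂ z + (L₁ y - L₂ y)) (h₂.add continuousOn_const)
    (fun z hz => by simp [exp_add, hk, hexp z hz]) hy (by ring) hx
  rw [this]
  ring

section Slices

variable {E : Type*} [NormedAddCommGroup E] [NormedSpace ℂ E]

/-- The parameters of the points of `D` on the complex line through `q'` and `q`. -/
def lineSlice (D : Set E) (q q' : E) : Set ℂ := {l | q' + l • (q - q') ∈ D}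

/-- All complex line slices of `D` are simply connected. -/
def SliceSC (D : Set E) : Prop :=
  ∀ q ∈ D, ∀ v : E, IsSimplyConnected {l : ℂ | q + l • v ∈ D}

lemma one_mem_lineSlice {D : Set E} {q q' : E} : 1 ∈ lineSlice D q q' ↔ q ∈ D := by
  simp [lineSlice]

lemma zero_mem_lineSlice {D : Set E} {q q' : E} : 0 ∈ lineSlice D q q' ↔ q' ∈ D := by
  simp [lineSlice]

lemma isOpen_lineSlice {D : Set E} (hD : IsOpen D) (q q' : E) : IsOpen (lineSlice D q q') :=
  hD.preimage (f := fun l : ℂ => q' + l • (q - q')) (by fun_prop)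

/-- `L` is a continuous logarithm of `h` along the slice of `D` by the line through `q'`
and `q`. -/
def IsLineLog (D : Set E) (h : E → ℂ) (q q' : E) (L : ℂ → ℂ) : Prop :=
  ContinuousOn L (lineSlice D q q') ∧ ∀ l ∈ lineSlice D q q', exp (L l) = h (q' + l • (q - q'))

open Classical in
/-- The increment from `q'` to `q` of a continuous logarithm of `h` along the line through them. -/
def logDiff (D : Set E) (h : E → ℂ) (q q' : E) : ℂ :=
  if H : ∃ L, IsLineLog D h q q' L then H.choose 1 - H.choose 0 else 0

/-- Pairs of points such that `h` does not vanish on the slice through them. -/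
def goodPairs (D : Set E) (h : E → ℂ) : Set (E × E) :=
  {x | x.1 ∈ D ∧ x.2 ∈ D ∧ ∀ l ∈ lineSlice D x.1 x.2, h (x.2 + l • (x.1 - x.2)) ≠ 0}

variable {D : Set E} {h : E → ℂ}

lemma SliceSC.lineSlice (hsc : SliceSC D) {q' : E} (hq' : q' ∈ D) (q : E) :
    IsSimplyConnected (lineSlice D q q') := hsc q' hq' (q - q')

lemma SliceSC.isPreconnected (hsc : SliceSC D) {q' : E} (hq' : q' ∈ D) (q : E) :
    IsPreconnected (_root_.lineSlice D q q') :=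
  (hsc.lineSlice hq' q).isPathConnected.isConnected.isPreconnected

lemma IsLineLog.logDiff_eq (hsc : SliceSC D) {q q' : E} (hq : q ∈ D) (hq' : q' ∈ D) {L : ℂ → ℂ}
    (hL : IsLineLog D h q q' L) : logDiff D h q q' = L 1 - L 0 := by
  have H : ∃ L, IsLineLog D h q q' L := ⟨L, hL⟩
  rw [logDiff, dif_pos H]
  exact sub_eq_sub_of_exp_eq (hsc.isPreconnected hq' q) H.choose_spec.1 hL.1
    (fun l hl => by rw [H.choose_spec.2 l hl, hL.2 l hl])
    (one_mem_lineSlice.2 hq) (zero_mem_lineSlice.2 hq')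

lemma exists_isLineLog (hD : IsOpen D) (hsc : SliceSC D) (hh : ContinuousOn h D) {q q' : E}
    (hP : (q, q') ∈ goodPairs D h) : ∃ L, IsLineLog D h q q' L := by
  obtain ⟨L, hL, hexp⟩ := exists_continuousOn_eqOn_exp_comp (hsc.lineSlice hP.2.1 q)
    (isOpen_lineSlice hD q q') (g := fun l : ℂ => h (q' + l • (q - q')))
    (hh.comp (by fun_prop) fun l hl => hl) (by rintro ⟨l, hl, hl0⟩; exact hP.2.2 l hl hl0)
  exact ⟨L, hL, hexp⟩

lemma exp_logDiff (hD : IsOpen D) (hsc : SliceSC D) (hh : ContinuousOn h D) {q q' : E}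
    (hP : (q, q') ∈ goodPairs D h) : exp (logDiff D h q q') = h q / h q' := by
  obtain ⟨L, hL⟩ := exists_isLineLog hD hsc hh hP
  rw [hL.logDiff_eq hsc hP.1 hP.2.1, exp_sub, hL.2 1 (one_mem_lineSlice.2 hP.1),
    hL.2 0 (zero_mem_lineSlice.2 hP.2.1)]
  simp

lemma eventually_logDiff_eq (hD : IsOpen D) (hsc : SliceSC D) (hh : ContinuousOn h D) {q₀ q₀' : E}
    (hP₀ : (q₀, q₀') ∈ goodPairs D h) :
    ∀ᶠ x in 𝓝 (q₀, q₀'), x ∈ goodPairs D h → logDiff D h x.1 x.2 =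
      logDiff D h q₀ q₀' + log (h x.1 / h q₀) - log (h x.2 / h q₀') := by
  obtain ⟨hq₀, hq₀', hne⟩ := hP₀
  obtain ⟨L₀, hL₀⟩ := exists_isLineLog hD hsc hh ⟨hq₀, hq₀', hne⟩
  have hj := (hsc.lineSlice hq₀' q₀).isPathConnected.joinedIn 0 (zero_mem_lineSlice.2 hq₀') 1
    (one_mem_lineSlice.2 hq₀)
  set γ := hj.somePath with hγ
  set K : Set ℂ := range γ with hK
  have hKs : K ⊆ lineSlice D q₀ q₀' := by
    rintro _ ⟨t, rfl⟩
    exact hj.somePath_mem t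
  have h0K : (0 : ℂ) ∈ K := ⟨0, γ.source⟩
  have h1K : (1 : ℂ) ∈ K := ⟨1, γ.target⟩
  have hKc : IsCompact K := isCompact_range γ.continuous
  have hKp : IsPreconnected K := isPreconnected_range γ.continuous
  have hev : ∀ᶠ x in 𝓝 (q₀, q₀'), ∀ l ∈ K, x.2 + l • (x.1 - x.2) ∈ D ∧
      ‖h (x.2 + l • (x.1 - x.2)) / h (q₀' + l • (q₀ - q₀')) - 1‖ < 1 := by
    refine hKc.eventually_forall_of_forall_eventually fun l hl => ?_
    have hc : Continuous fun z : (E × E) × ℂ => z.1.2 + z.2 • (z.1.1 - z.1.2) := by fun_prop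
    have hc' : Continuous fun z : (E × E) × ℂ => q₀' + z.2 • (q₀ - q₀') := by fun_prop
    have hlD : q₀' + l • (q₀ - q₀') ∈ D := hKs hl
    have hhat : ContinuousAt h (q₀' + l • (q₀ - q₀')) := hh.continuousAt (hD.mem_nhds hlD)
    have hcA : ContinuousAt (fun z : (E × E) × ℂ => h (z.1.2 + z.2 • (z.1.1 - z.1.2)))
        ((q₀, q₀'), l) := ContinuousAt.comp (g := h) hhat hc.continuousAt
    have hcB : ContinuousAt (fun z : (E × E) × ℂ => h (q₀' + z.2 • (q₀ - q₀')))
        ((q₀, q₀'), l) := ContinuousAt.comp (g := h) hhat hc'.continuousAt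
    have hcr := ((hcA.div hcB (hne l (hKs hl))).sub continuousAt_const (g := fun _ => (1 : ℂ))).norm
    have h1 : ∀ᶠ z in 𝓝 ((q₀, q₀'), l), z.1.2 + z.2 • (z.1.1 - z.1.2) ∈ D :=
      hc.continuousAt (hD.mem_nhds hlD)
    refine h1.and (hcr.eventually_lt_const ?_)
    simp [div_self (hne l (hKs hl))]
  filter_upwards [hev] with x hx hxP
  obtain ⟨L, hL⟩ := exists_isLineLog hD hsc hh hxP
  have hKx : K ⊆ lineSlice D x.1 x.2 := fun l hl => (hx l hl).1
  have hγx : ContinuousOn (fun l : ℂ => h (x.2 + l • (x.1 - x.2))) K :=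
    hh.comp (by fun_prop) fun l hl => hKx hl
  have hγ0 : ContinuousOn (fun l : ℂ => h (q₀' + l • (q₀ - q₀'))) K :=
    hh.comp (by fun_prop) fun l hl => hKs hl
  have hM : ContinuousOn (fun l : ℂ => L₀ l +
      log (h (x.2 + l • (x.1 - x.2)) / h (q₀' + l • (q₀ - q₀')))) K := by
    refine (hL₀.1.mono hKs).add ((hγx.div hγ0 fun l hl => hne l (hKs hl)).clog fun l hl => ?_)
    have := mem_slitPlane_of_norm_lt_one (hx l hl).2
    rwa [add_sub_cancel] at this
  have := sub_eq_sub_of_exp_eq hKp (hL.1.mono hKx) hM (fun l hl => by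
    have h0 := hne l (hKs hl)
    rw [hL.2 l (hKx hl), exp_add, hL₀.2 l (hKs hl), exp_log
      (div_ne_zero (hxP.2.2 l (hKx hl)) h0), mul_div_cancel₀ _ h0]) h1K h0K
  rw [hL.logDiff_eq hsc hxP.1 hxP.2.1, hL₀.logDiff_eq hsc hq₀ hq₀', this]
  simp only [one_smul, zero_smul, add_zero, add_sub_cancel]
  ring

lemma continuousOn_logDiff (hD : IsOpen D) (hsc : SliceSC D) (hh : ContinuousOn h D) :
    ContinuousOn (fun x : E × E => logDiff D h x.1 x.2) (goodPairs D h) := by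
  rintro ⟨q₀, q₀'⟩ hP
  have h1 : h q₀ ≠ 0 := by simpa using hP.2.2 1 (one_mem_lineSlice.2 hP.1)
  have h2 : h q₀' ≠ 0 := by simpa using hP.2.2 0 (zero_mem_lineSlice.2 hP.2.1)
  have hc1 : ContinuousAt (fun x : E × E => h x.1) (q₀, q₀') :=
    ContinuousAt.comp (g := h) (hh.continuousAt (hD.mem_nhds hP.1)) continuousAt_fst
  have hc2 : ContinuousAt (fun x : E × E => h x.2) (q₀, q₀') :=
    ContinuousAt.comp (g := h) (hh.continuousAt (hD.mem_nhds hP.2.1)) continuousAt_snd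
  have hcont : ContinuousAt (fun x : E × E => logDiff D h q₀ q₀' + log (h x.1 / h q₀) -
      log (h x.2 / h q₀')) (q₀, q₀') :=
    ((hc1.div_const _).clog (by simp [div_self h1])).const_add _ |>.sub
      ((hc2.div_const _).clog (by simp [div_self h2]))
  refine hcont.continuousWithinAt.congr_of_eventuallyEq ?_ ?_
  · filter_upwards [nhdsWithin_le_nhds (eventually_logDiff_eq hD hsc hh hP),
      self_mem_nhdsWithin] with x hx hxP using hx hxP
  · simp [div_self h1, div_self h2]

/-- The increments satisfy the cocycle identity on subsets of `D` closed under line slices. -/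
lemma logDiff_sub_logDiff (hD : IsOpen D) (hsc : SliceSC D) (hh : ContinuousOn h D) {C : Set E}
    (hCD : C ⊆ D) (hC : ∀ q ∈ C, ∀ q' ∈ C, ∀ l ∈ lineSlice D q q', q' + l • (q - q') ∈ C)
    (hne : ∀ q ∈ C, h q ≠ 0) {q q' p : E} (hq : q ∈ C) (hq' : q' ∈ C) (hp : p ∈ C) :
    logDiff D h q p - logDiff D h q' p = logDiff D h q q' := by
  have hgood : ∀ x ∈ C, ∀ y ∈ C, (x, y) ∈ goodPairs D h := fun x hx y hy =>
    ⟨hCD hx, hCD hy, fun l hl => hne _ (hC x hx y hy l hl)⟩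
  have hL : IsLineLog D h q q' (fun l => logDiff D h (q' + l • (q - q')) p +
      log (h p)) := by
    refine ⟨ContinuousOn.add ?_ continuousOn_const, fun l hl => ?_⟩
    · exact (continuousOn_logDiff hD hsc hh).comp (f := fun l : ℂ => (q' + l • (q - q'), p))
        (by fun_prop) fun l hl => hgood _ (hC q hq q' hq' l hl) p hp
    · rw [exp_add, exp_logDiff hD hsc hh (hgood _ (hC q hq q' hq' l hl) p hp),
        exp_log (hne p hp), div_mul_cancel₀ _ (hne p hp)]
  rw [hL.logDiff_eq hsc (hCD hq) (hCD hq')]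
  simp

/-- Images of `D` under linear functionals admit holomorphic logarithms. -/
theorem SliceSC.hasLog_image (hD : IsOpen D) (hsc : SliceSC D) {ℓ : E →L[ℂ] ℂ} {e : E}
    (he : ℓ e = 1) : HasLog (ℓ '' D) := by
  intro g hg hg0
  have hℓ : ℓ ≠ 0 := by
    rintro rfl
    simp at he
  have hG : IsOpen (ℓ '' D) := ℓ.isOpenMap_of_ne_zero hℓ D hD
  rcases D.eq_empty_or_nonempty with rfl | ⟨p, hp⟩
  · exact ⟨0, by simp, by simp⟩
  have hh : ContinuousOn (fun q => g (ℓ q)) D :=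
    hg.continuousOn.comp ℓ.continuous.continuousOn (mapsTo_image ℓ D)
  have hne : ∀ q ∈ D, g (ℓ q) ≠ 0 := fun q hq => hg0 _ (mem_image_of_mem ℓ hq)
  have hgood : ∀ x ∈ D, ∀ y ∈ D, (x, y) ∈ goodPairs D (fun q => g (ℓ q)) := fun x hx y hy =>
    ⟨hx, hy, fun l hl => hne _ hl⟩
  set A : E → ℂ := fun q => logDiff D (fun q => g (ℓ q)) q p with hA
  have hAc : ContinuousOn A D := (continuousOn_logDiff hD hsc hh).comp (f := fun q : E => (q, p))
    (by fun_prop) fun q hq => hgood q hq p hp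
  have hAf : ∀ q ∈ D, ∀ q' ∈ D, ℓ q = ℓ q' → A q = A q' := by
    intro q hq q' hq' hqq'
    have hL : IsLineLog D (fun q => g (ℓ q)) q q' (fun _ => log (g (ℓ q'))) :=
      ⟨continuousOn_const, fun l _ => by simp [hqq', exp_log (hne q' hq')]⟩
    have := logDiff_sub_logDiff hD hsc hh Subset.rfl (fun q _ q' _ l hl => hl) hne hq hq' hp
    rw [hL.logDiff_eq hsc hq hq', sub_self] at this
    exact sub_eq_zero.1 this
  choose! σ hσD hσ using fun c (hc : c ∈ ℓ '' D) => hc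
  have hLc : ContinuousOn (fun c => A (σ c) + log (g (ℓ p))) (ℓ '' D) := by
    refine ContinuousOn.add (fun c₀ hc₀ => ContinuousAt.continuousWithinAt ?_) continuousOn_const
    have hcont : Continuous fun c : ℂ => σ c₀ + (c - c₀) • e := by fun_prop
    have h0 : σ c₀ + (c₀ - c₀) • e = σ c₀ := by simp
    have hD' : D ∈ 𝓝 (σ c₀ + (c₀ - c₀) • e) := by
      rw [h0]
      exact hD.mem_nhds (hσD c₀ hc₀)
    have : ContinuousAt (fun c : ℂ => A (σ c₀ + (c - c₀) • e)) c₀ :=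
      ContinuousAt.comp (g := A) (f := fun c : ℂ => σ c₀ + (c - c₀) • e)
        (hAc.continuousAt hD') hcont.continuousAt
    refine this.congr ?_
    filter_upwards [hG.mem_nhds hc₀, hcont.continuousAt hD'] with c hc hcD
    exact hAf _ hcD _ (hσD c hc) (by simp [he, hσ c hc, hσ c₀ hc₀])
  have hLexp : ∀ c ∈ ℓ '' D, exp (A (σ c) + log (g (ℓ p))) = g c := fun c hc => by
    rw [exp_add, hA, exp_logDiff hD hsc hh (hgood _ (hσD c hc) p hp), exp_log (hne p hp),
      div_mul_cancel₀ _ (hne p hp), hσ c hc]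
  exact ⟨_, differentiableOn_of_exp_eq hG hLc hg hLexp, hLexp⟩

end Slices

section Hyperplanes

variable {F : Type*} {D : Set (F × ℂ × ℂ)}

/-- The part of `D` over the slopes of modulus less than `R`, where the slope of `(x, s, w)` is
`w / s`. -/
def slopeSet (D : Set (F × ℂ × ℂ)) (R : ℝ) : Set (F × ℂ × ℂ) :=
  {q | q ∈ D ∧ q.2.1 ≠ 0 ∧ ‖q.2.2 / q.2.1‖ < R}

/-- The part of `D` with slope `m`. -/
def slopeFibre (D : Set (F × ℂ × ℂ)) (m : ℂ) : Set (F × ℂ × ℂ) := {q | q ∈ D ∧ q.2.2 = m * q.2.1}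

lemma snd_fst_ne_zero_of_mem_slopeFibre (h0 : ∀ x, (x, (0 : ℂ), (0 : ℂ)) ∉ D) {m : ℂ}
    {q : F × ℂ × ℂ} (hq : q ∈ slopeFibre D m) : q.2.1 ≠ 0 := by
  intro h
  have h2 : q.2.2 = 0 := by rw [hq.2, h, mul_zero]
  refine h0 q.1 ?_
  rw [← h, ← (show q.2.2 = q.2.1 by rw [h2, h])]
  have : (q.1, q.2.2, q.2.2) = q := by
    ext
    · rfl
    · exact h2.trans h.symm
    · rfl
  exact this ▸ hq.1

lemma mem_slopeFibre {q : F × ℂ × ℂ} (hq : q ∈ D) (hs : q.2.1 ≠ 0) :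
    q ∈ slopeFibre D (q.2.2 / q.2.1) := ⟨hq, (div_mul_cancel₀ _ hs).symm⟩

lemma continuousAt_slope [TopologicalSpace F] {q : F × ℂ × ℂ} (hs : q.2.1 ≠ 0) :
    ContinuousAt (fun q : F × ℂ × ℂ => q.2.2 / q.2.1) q :=
  ContinuousAt.div (by fun_prop) (by fun_prop) hs

lemma isOpen_slopeSet [TopologicalSpace F] (hD : IsOpen D) (R : ℝ) : IsOpen (slopeSet D R) := by
  refine isOpen_iff_mem_nhds.2 fun q hq => ?_
  have h1 : ∀ᶠ p : F × ℂ × ℂ in 𝓝 q, p.2.1 ≠ 0 :=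
    ContinuousAt.eventually_ne (by fun_prop) hq.2.1
  filter_upwards [hD.mem_nhds hq.1, h1,
    (continuousAt_slope hq.2.1).norm.eventually_lt_const hq.2.2] with p hp1 hp2 hp3
  exact ⟨hp1, hp2, hp3⟩

variable [NormedAddCommGroup F] [NormedSpace ℂ F]

lemma slopeFibre_closed {m : ℂ} {q q' : F × ℂ × ℂ} (hq : q ∈ slopeFibre D m)
    (hq' : q' ∈ slopeFibre D m) {l : ℂ} (hl : l ∈ lineSlice D q q') :
    q' + l • (q - q') ∈ slopeFibre D m := by
  refine ⟨hl, ?_⟩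
  simp only [Prod.snd_add, Prod.smul_snd, Prod.snd_sub, Prod.fst_add, Prod.smul_fst, Prod.fst_sub,
    smul_eq_mul, hq.2, hq'.2]
  ring

lemma mem_goodPairs_of_mem_slopeFibre (h0 : ∀ x, (x, (0 : ℂ), (0 : ℂ)) ∉ D) {m : ℂ}
    {q q' : F × ℂ × ℂ} (hq : q ∈ slopeFibre D m) (hq' : q' ∈ slopeFibre D m) :
    (q, q') ∈ goodPairs D (fun q => q.2.1) :=
  ⟨hq.1, hq'.1, fun _ hl => snd_fst_ne_zero_of_mem_slopeFibre h0 (slopeFibre_closed hq hq' hl)⟩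

lemma continuousAt_logDiff_comp {E α : Type*} [NormedAddCommGroup E] [NormedSpace ℂ E]
    [TopologicalSpace α] {D : Set E} {h : E → ℂ} (hD : IsOpen D) (hsc : SliceSC D)
    (hh : ContinuousOn h D) {f g : α → E} {a : α} (hf : ContinuousAt f a) (hg : ContinuousAt g a)
    (hgood : ∀ᶠ x in 𝓝 a, (f x, g x) ∈ goodPairs D h) :
    ContinuousAt (fun x => logDiff D h (f x) (g x)) a :=
  Filter.Tendsto.comp (g := fun x : E × E => logDiff D h x.1 x.2) (f := fun x => (f x, g x))
    (continuousOn_logDiff hD hsc hh _ hgood.self_of_nhds)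
    (tendsto_nhdsWithin_iff.2 ⟨hf.prodMk hg, hgood⟩)

lemma continuousAt_cutoff_mul_logDiff (hD : IsOpen D) (hsc : SliceSC D)
    (h0 : ∀ x, (x, (0 : ℂ), (0 : ℂ)) ∉ D) {x : F} {c k : ℂ} {r : ℝ} (hr : 0 < r)
    (hσ : ∀ m ∈ ball k (2 * r), (x, c, m * c) ∈ D) {χ : ℂ → ℂ} (hχ : Continuous χ)
    (hχ0 : ∀ m, r < dist m k → χ m = 0) {q : F × ℂ × ℂ} (hq : q ∈ D) (hs : q.2.1 ≠ 0) :
    ContinuousAt (fun q : F × ℂ × ℂ => χ (q.2.2 / q.2.1) *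
      logDiff D (fun q => q.2.1) q (x, c, q.2.2 / q.2.1 * c)) q := by
  have hmq := continuousAt_slope hs
  by_cases hk : q.2.2 / q.2.1 ∈ ball k (2 * r)
  · refine ContinuousAt.mul (ContinuousAt.comp (g := χ) hχ.continuousAt hmq) ?_
    refine continuousAt_logDiff_comp hD hsc (by fun_prop) continuousAt_id
      (continuousAt_const.prodMk (continuousAt_const.prodMk (hmq.mul continuousAt_const))) ?_
    have hs' : ∀ᶠ p : F × ℂ × ℂ in 𝓝 q, p.2.1 ≠ 0 := ContinuousAt.eventually_ne (by fun_prop) hs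
    filter_upwards [hD.mem_nhds hq, hs', hmq (isOpen_ball.mem_nhds hk)] with p hp hp1 hpk
    exact mem_goodPairs_of_mem_slopeFibre h0 (mem_slopeFibre hp hp1) ⟨hσ _ hpk, rfl⟩
  · have hk' : r < dist (q.2.2 / q.2.1) k := by
      rw [mem_ball, not_lt] at hk
      linarith
    refine (continuousAt_const (y := (0 : ℂ))).congr ?_
    filter_upwards [(hmq.dist continuousAt_const).eventually_const_lt hk'] with p hp
    rw [hχ0 _ hp, zero_mul]

/-- If the slope fibres are all nonempty, the increments of the logarithm of the second coordinate
along the slope fibres are induced by a single continuous function. -/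
lemma exists_continuousOn_sub_eq_logDiff (hD : IsOpen D) (hsc : SliceSC D)
    (h0 : ∀ x, (x, (0 : ℂ), (0 : ℂ)) ∉ D) (hm : ∀ m : ℂ, ∃ x c, (x, c, m * c) ∈ D) (R : ℝ) :
    ∃ A : F × ℂ × ℂ → ℂ, ContinuousOn A (slopeSet D R) ∧ ∀ m ∈ ball (0 : ℂ) R,
      ∀ q ∈ slopeFibre D m, ∀ q' ∈ slopeFibre D m,
        A q - A q' = logDiff D (fun q => q.2.1) q q' := by
  have hh : ContinuousOn (fun q : F × ℂ × ℂ => q.2.1) D := by fun_prop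
  choose x c hxc using hm
  have hr : ∀ k : ℂ, ∃ r > 0, ∀ m ∈ ball k (2 * r), (x k, c k, m * c k) ∈ D := by
    intro k
    have hcont : Continuous fun m : ℂ => (x k, c k, m * c k) := by fun_prop
    obtain ⟨r, hr, hball⟩ := Metric.mem_nhds_iff.1 (hcont.continuousAt (hD.mem_nhds (hxc k)))
    exact ⟨r / 2, half_pos hr, fun m hm => hball (by rwa [mul_div_cancel₀ _ two_ne_zero] at hm)⟩
  choose r hr hrD using hr
  obtain ⟨t, -, htcov⟩ := (isCompact_closedBall (0 : ℂ) R).elim_nhds_subcover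
    (fun k => ball k (r k)) fun k _ => ball_mem_nhds k (hr k)
  set χ : ℂ → ℂ → ℝ := fun k m => max 0 (r k - dist m k) with hχ
  have hχc : ∀ k, Continuous (χ k) := fun k => by fun_prop
  have hχ0 : ∀ k m, 0 ≤ χ k m := fun k m => le_max_left _ _
  have hW : ∀ m ∈ ball (0 : ℂ) R, 0 < ∑ k ∈ t, χ k m := by
    intro m hm
    obtain ⟨k, hk, hmk⟩ := mem_iUnion₂.1 (htcov (ball_subset_closedBall hm))
    refine Finset.sum_pos' (fun k _ => hχ0 k m) ⟨k, hk, lt_max_of_lt_right ?_⟩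
    exact sub_pos.2 hmk
  have hσ : ∀ k, ∀ m ∈ ball k (2 * r k), (x k, c k, m * c k) ∈ slopeFibre D m := fun k m hm =>
    ⟨hrD k m hm, rfl⟩
  have hχne : ∀ k m, χ k m ≠ 0 → m ∈ ball k (2 * r k) := by
    intro k m hne
    by_contra hcon
    rw [mem_ball, not_lt] at hcon
    exact hne (max_eq_left (by linarith [hr k]))
  refine ⟨fun q => (∑ k ∈ t, (χ k (q.2.2 / q.2.1) : ℂ) *
    logDiff D (fun q => q.2.1) q (x k, c k, q.2.2 / q.2.1 * c k)) /
    ((∑ k ∈ t, χ k (q.2.2 / q.2.1) : ℝ) : ℂ), ?_, ?_⟩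
  · refine ContinuousOn.div (continuousOn_finsetSum _ fun k _ => ?_) ?_ ?_
    · intro q hq
      refine (continuousAt_cutoff_mul_logDiff hD hsc h0 (hr k) (hrD k)
        (χ := fun m => (χ k m : ℂ)) (continuous_ofReal.comp (hχc k)) (fun m hm => ?_)
        hq.1 hq.2.1).continuousWithinAt
      rw [hχ, ofReal_eq_zero]
      exact max_eq_left (sub_nonpos.2 hm.le)
    · intro q hq
      have hc := (continuous_finsetSum t fun k _ => hχc k).continuousAt
        (x := q.2.2 / q.2.1)
      refine ContinuousAt.continuousWithinAt (continuous_ofReal.continuousAt.comp ?_)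
      exact ContinuousAt.comp (g := fun m => ∑ k ∈ t, χ k m) hc (continuousAt_slope hq.2.1)
    · intro q hq
      exact_mod_cast (hW _ (mem_ball_zero_iff.2 hq.2.2)).ne'
  · intro m hm q hq q' hq'
    have hmq : ∀ p ∈ slopeFibre D m, p.2.2 / p.2.1 = m := fun p hp => by
      rw [hp.2, mul_div_cancel_right₀ _ (snd_fst_ne_zero_of_mem_slopeFibre h0 hp)]
    have hWne : ((∑ k ∈ t, χ k m : ℝ) : ℂ) ≠ 0 := by exact_mod_cast (hW m hm).ne'
    simp only [hmq q hq, hmq q' hq']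
    rw [← sub_div, ← Finset.sum_sub_distrib, div_eq_iff hWne, ofReal_sum, Finset.mul_sum]
    refine Finset.sum_congr rfl fun k _ => ?_
    rw [← mul_sub, mul_comm (logDiff D _ q q')]
    rcases eq_or_ne (χ k m) 0 with hk | hk
    · rw [hk, ofReal_zero, zero_mul, zero_mul]
    · congr 1
      exact logDiff_sub_logDiff hD hsc hh (C := slopeFibre D m) (fun p hp => hp.1)
        (fun p hp p' hp' l hl => slopeFibre_closed hp hp' hl)
        (fun p hp => snd_fst_ne_zero_of_mem_slopeFibre h0 hp) hq hq' (hσ k m (hχne k m hk))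

/-- If the slope fibres are all nonempty, the second coordinate has a continuous logarithm over the
slopes in any disc. -/
lemma exists_continuousOn_log_slopeSet (hD : IsOpen D) (hsc : SliceSC D)
    (h0 : ∀ x, (x, (0 : ℂ), (0 : ℂ)) ∉ D) (hm : ∀ m : ℂ, ∃ x c, (x, c, m * c) ∈ D) {R : ℝ}
    (hR : 0 < R) :
    ∃ Λ : F × ℂ × ℂ → ℂ, ContinuousOn Λ (slopeSet D R) ∧
      ∀ q ∈ slopeSet D R, exp (Λ q) = q.2.1 := by
  have hh : ContinuousOn (fun q : F × ℂ × ℂ => q.2.1) D := by fun_prop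
  obtain ⟨A, hAc, hA⟩ := exists_continuousOn_sub_eq_logDiff hD hsc h0 hm R
  have hconst : ∀ m ∈ ball (0 : ℂ) R, ∀ q ∈ slopeFibre D m, ∀ q' ∈ slopeFibre D m,
      exp (A q) / q.2.1 = exp (A q') / q'.2.1 := by
    intro m hm q hq q' hq'
    have := exp_logDiff hD hsc hh (mem_goodPairs_of_mem_slopeFibre h0 hq hq')
    rw [← hA m hm q hq q' hq', exp_sub, div_eq_div_iff (exp_ne_zero _)
      (snd_fst_ne_zero_of_mem_slopeFibre h0 hq')] at this
    rw [div_eq_div_iff (snd_fst_ne_zero_of_mem_slopeFibre h0 hq)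
      (snd_fst_ne_zero_of_mem_slopeFibre h0 hq')]
    linear_combination this
  choose x c hxc using hm
  have hfib : ∀ k m, (x k, c k, m * c k) ∈ D → (x k, c k, m * c k) ∈ slopeFibre D m :=
    fun k m h => ⟨h, rfl⟩
  have hc0 : ∀ k, c k ≠ 0 := fun k => snd_fst_ne_zero_of_mem_slopeFibre h0 (hfib k k (hxc k))
  have hu : ContinuousOn (fun m => exp (A (x m, c m, m * c m)) / c m) (ball 0 R) := by
    intro k hk
    refine ContinuousAt.continuousWithinAt ?_
    have hcont : Continuous fun m : ℂ => (x k, c k, m * c k) := by fun_prop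
    have hmem : (x k, c k, k * c k) ∈ slopeSet D R :=
      ⟨hxc k, hc0 k, by rwa [mul_div_cancel_right₀ _ (hc0 k), ← mem_ball_zero_iff]⟩
    have hAk : ContinuousAt (fun m : ℂ => A (x k, c k, m * c k)) k :=
      ContinuousAt.comp (g := A) (f := fun m : ℂ => (x k, c k, m * c k))
        (hAc.continuousAt ((isOpen_slopeSet hD R).mem_nhds hmem)) hcont.continuousAt
    refine (hAk.cexp.div_const (c k)).congr ?_
    filter_upwards [isOpen_ball.mem_nhds hk, hcont.continuousAt (hD.mem_nhds (hxc k))] with m hm hmD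
    exact hconst m hm _ (hfib k m hmD) _ (hfib m m (hxc m))
  obtain ⟨v, hv, hvexp⟩ := exists_continuousOn_eqOn_exp_comp
    (isSimplyConnected_of_convex (convex_ball (0 : ℂ) R) ⟨0, mem_ball_self hR⟩) isOpen_ball hu (by
      rintro ⟨m, -, hm⟩
      exact div_ne_zero (exp_ne_zero _) (hc0 m) hm)
  refine ⟨fun q => A q - v (q.2.2 / q.2.1), hAc.sub (hv.comp ?_ ?_), fun q hq => ?_⟩
  · exact fun q hq => (continuousAt_slope hq.2.1).continuousWithinAt
  · exact fun q hq => mem_ball_zero_iff.2 hq.2.2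
  · have hmR : q.2.2 / q.2.1 ∈ ball (0 : ℂ) R := mem_ball_zero_iff.2 hq.2.2
    have := hvexp hmR
    simp only [Function.comp_apply] at this
    rw [exp_sub, this, ← hconst _ hmR q (mem_slopeFibre hq.1 hq.2.1) _ (hfib _ _ (hxc _)),
      div_div_cancel₀ (exp_ne_zero _)]

lemma no_continuousOn_log_circle {ε : ℝ} (hε : 0 < ε) {L : ℂ → ℂ}
    (hL : ContinuousOn L (sphere 0 ε)) (hexp : ∀ z ∈ sphere (0 : ℂ) ε, exp (L z) = z) : False := by
  have hmem : ∀ θ : ℝ, circleMap 0 ε θ ∈ sphere (0 : ℂ) ε := fun θ =>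
    circleMap_mem_sphere 0 hε.le θ
  have := sub_eq_sub_of_exp_eq (isPreconnected_univ (α := ℝ)) (L₁ := fun θ => L (circleMap 0 ε θ))
    (L₂ := fun θ => log ε + θ * I) (hL.comp (continuous_circleMap 0 ε).continuousOn
      fun θ _ => hmem θ) (by fun_prop) (fun θ _ => by
        have : (ε : ℂ) ≠ 0 := by exact_mod_cast hε.ne'
        rw [hexp _ (hmem θ), exp_add, exp_log this, circleMap_zero])
    (mem_univ (2 * π)) (mem_univ 0)
  simp [circleMap, Real.pi_ne_zero] at this

/-- If a slice-simply-connected open set meets all planes `w = m s` and `s = 0` then it meets the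
axis `s = w = 0`. -/
theorem exists_mem_axis (hD : IsOpen D) (hsc : SliceSC D)
    (hm : ∀ m : ℂ, ∃ x c, (x, c, m * c) ∈ D) (hinf : ∃ x b, (x, (0 : ℂ), b) ∈ D) :
    ∃ x, (x, (0 : ℂ), (0 : ℂ)) ∈ D := by
  by_contra! h0
  obtain ⟨x, b, hb⟩ := hinf
  have hcont : Continuous fun s : ℂ => (x, s, b) := by fun_prop
  obtain ⟨r, hr, hball⟩ := Metric.mem_nhds_iff.1 (hcont.continuousAt (hD.mem_nhds hb))
  have hε := half_pos hr
  obtain ⟨Λ, hΛ, hexp⟩ := exists_continuousOn_log_slopeSet hD hsc h0 hm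
    (R := ‖b‖ / (r / 2) + 1) (by positivity)
  have hmem : ∀ s ∈ sphere (0 : ℂ) (r / 2), (x, s, b) ∈ slopeSet D (‖b‖ / (r / 2) + 1) := by
    intro s hs
    have hs' : ‖s‖ = r / 2 := mem_sphere_zero_iff_norm.1 hs
    refine ⟨hball (mem_ball_zero_iff.2 (by linarith)), norm_pos_iff.1 (hs' ▸ hε), ?_⟩
    rw [norm_div, hs']
    exact lt_add_one _
  exact no_continuousOn_log_circle hε (hΛ.comp hcont.continuousOn hmem) fun s hs =>
    hexp _ (hmem s hs)

end Hyperplanes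

lemma IsCConvex.sliceSC {n : ℕ} {D : Set (Cn n)} (hcc : IsCConvex D) : SliceSC D := by
  intro q hq v
  rcases eq_or_ne v 0 with rfl | hv
  · simpa [hq] using isSimplyConnected_of_convex (convex_univ (𝕜 := ℝ) (E := ℂ)) univ_nonempty
  · have hemb : Topology.IsEmbedding fun l : ℂ => q + l • v :=
      (Homeomorph.addLeft q).isEmbedding.comp (isClosedEmbedding_smul_left hv).isEmbedding
    rw [← hemb.isSimplyConnected_image]
    have : (fun l : ℂ => q + l • v) '' {l : ℂ | q + l • v ∈ D} = D ∩ cline q v := by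
      ext w
      constructor
      · rintro ⟨l, hl, rfl⟩
        exact ⟨hl, l, rfl⟩
      · rintro ⟨hw, l, rfl⟩
        exact ⟨l, hw, rfl⟩
    rw [this]
    exact (hcc q v hv ⟨q, hq, 0, by simp⟩).2

section

variable {E : Type*} [NormedAddCommGroup E] [NormedSpace ℂ E] {D : Set E}

lemma SliceSC.preimage (hsc : SliceSC D) {E' : Type*} [NormedAddCommGroup E'] [NormedSpace ℂ E']
    (g : E' →L[ℂ] E) (a : E) : SliceSC {p | a + g p ∈ D} := by
  intro p hp v
  simpa [add_assoc] using hsc (a + g p) hp (g v)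

/-- Through every point outside a slice-simply-connected open set there is a complex hyperplane
missing it. -/
theorem SliceSC.exists_hyperplane [FiniteDimensional ℂ E] (hD : IsOpen D) (hsc : SliceSC D)
    (hne : D.Nonempty) {a : E} (ha : a ∉ D) :
    ∃ ℓ : E →L[ℂ] ℂ, ℓ ≠ 0 ∧ ∀ q ∈ D, ℓ q ≠ ℓ a := by
  obtain ⟨M, hM, hmax⟩ := (wellFounded_gt (α := Submodule ℂ E)).has_min
    {M | ∀ v ∈ M, a + v ∉ D} ⟨⊥, by simpa using ha⟩
  have hhit : ∀ v ∉ M, ∃ μ ∈ M, ∃ c : ℂ, a + μ + c • v ∈ D := by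
    intro v hv
    by_contra! hcon
    refine hmax (M ⊔ Submodule.span ℂ {v}) (fun w hw => ?_) ?_
    · obtain ⟨μ, hμ, u, hu, rfl⟩ := Submodule.mem_sup.1 hw
      obtain ⟨c, rfl⟩ := Submodule.mem_span_singleton.1 hu
      rw [← add_assoc]
      exact hcon μ hμ c
    · refine left_lt_sup.2 fun h => hv (h (Submodule.mem_span_singleton_self v))
  obtain ⟨q₀, hq₀⟩ := hne
  have hx : q₀ - a ∉ M := fun h => hM _ h (by simpa using hq₀)
  set x := q₀ - a
  by_cases htop : M ⊔ Submodule.span ℂ {x} = ⊤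
  · obtain ⟨f, hfx, hf⟩ := Submodule.exists_le_ker_of_notMem hx
    refine ⟨f.toContinuousLinearMap, fun h => hfx ?_, fun q hq heq => ?_⟩
    · simpa using congrArg (fun g : E →L[ℂ] ℂ => g x) h
    · have hmem : q - a ∈ M ⊔ Submodule.span ℂ {x} := htop ▸ Submodule.mem_top
      obtain ⟨μ, hμ, u, hu, hqa⟩ := Submodule.mem_sup.1 hmem
      obtain ⟨c, rfl⟩ := Submodule.mem_span_singleton.1 hu
      have h0 : f (q - a) = 0 := by
        rw [map_sub]
        exact sub_eq_zero.2 heq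
      have hfμ : f μ = 0 := hf hμ
      rw [← hqa, map_add, hfμ, map_smul, zero_add, smul_eq_mul, mul_eq_zero,
        or_iff_left hfx] at h0
      rw [h0, zero_smul, add_zero] at hqa
      exact hM μ hμ (by rwa [hqa, add_sub_cancel])
  · obtain ⟨y, -, hy⟩ := SetLike.exists_of_lt (lt_top_iff_ne_top.2 htop)
    have hyx : ∀ m : ℂ, x + m • y ∉ M := by
      intro m hm
      rcases eq_or_ne m 0 with rfl | hm0
      · exact hx (by simpa using hm)
      · refine hy ((Submodule.smul_mem_iff _ hm0).1 ?_)
        rw [← add_sub_cancel_left x (m • y)]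
        exact sub_mem (Submodule.mem_sup_left hm)
          (Submodule.mem_sup_right (Submodule.mem_span_singleton_self x))
    let g : M × ℂ × ℂ →L[ℂ] E := M.subtypeL.coprod
      ((ContinuousLinearMap.toSpanSingleton ℂ x).coprod (ContinuousLinearMap.toSpanSingleton ℂ y))
    have hg : ∀ μ s w, a + g (μ, s, w) = a + μ + (s • x + w • y) := by
      intro μ s w
      simp [g, add_assoc]
    obtain ⟨μ, hμ⟩ := exists_mem_axis (D := {p | a + g p ∈ D})
      (hD.preimage (f := fun p => a + g p) (by fun_prop)) (hsc.preimage g a) (fun m => by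
        obtain ⟨μ, hμ, c, hc⟩ := hhit _ (hyx m)
        refine ⟨⟨μ, hμ⟩, c, ?_⟩
        rw [mem_ofPred, hg]
        convert hc using 2
        module) (by
        obtain ⟨μ, hμ, c, hc⟩ := hhit y fun h => hy (Submodule.mem_sup_left h)
        refine ⟨⟨μ, hμ⟩, c, ?_⟩
        rw [mem_ofPred, hg]
        simpa using hc)
    rw [mem_ofPred, hg] at hμ
    exact (hM μ μ.2 (by simpa using hμ)).elim

theorem SliceSC.exists_le_norm_fderiv [FiniteDimensional ℂ E] (hD : IsOpen D) (hsc : SliceSC D)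
    {z X : E} (hz : z ∈ D) {l : ℂ} (hl : z + l • X ∉ D) {t : ℝ} (ht0 : 0 < t) (ht1 : t < 1) :
    ∃ f : E → ℂ, DifferentiableOn ℂ f D ∧ MapsTo f D (ball 0 1) ∧ f z = 0 ∧
      t ≤ 4 * ‖l‖ * ‖fderiv ℂ f z X‖ := by
  set a := z + l • X with ha
  obtain ⟨ℓ, hℓ, hℓD⟩ := hsc.exists_hyperplane hD ⟨z, hz⟩ hl
  obtain ⟨v, hv⟩ : ∃ v, ℓ v ≠ 0 := by
    by_contra! h
    exact hℓ (ContinuousLinearMap.ext h)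
  have he : ℓ ((ℓ v)⁻¹ • v) = 1 := by simp [hv]
  set D₀ : Set E := {q | a + ContinuousLinearMap.id ℂ E q ∈ D} with hD₀
  have hD₀o : IsOpen D₀ := hD.preimage (f := fun q => a + ContinuousLinearMap.id ℂ E q)
    (by fun_prop)
  have hlog := (hsc.preimage (ContinuousLinearMap.id ℂ E) a).hasLog_image hD₀o he
  have hG : IsOpen (ℓ '' D₀) := ℓ.isOpenMap_of_ne_zero hℓ D₀ hD₀o
  have h0 : (0 : ℂ) ∉ ℓ '' D₀ := by
    rintro ⟨q, hq, hq0⟩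
    exact hℓD _ hq (by simp [hq0])
  have hmaps : MapsTo (fun q => ℓ (q - a)) D (ℓ '' D₀) := fun q hq =>
    mem_image_of_mem ℓ (by simpa [hD₀] using hq)
  obtain ⟨F, hF, hFm, hF0, hFt⟩ := exists_norm_deriv_ge hG hlog h0 (hmaps hz) ht0 ht1
  have hdiff : Differentiable ℂ fun q => ℓ (q - a) := by fun_prop
  refine ⟨fun q => F (ℓ (q - a)), hF.comp hdiff.differentiableOn hmaps, hFm.comp hmaps, hF0,
    hFt.trans_eq ?_⟩
  have hder : HasFDerivAt (fun q => F (ℓ (q - a))) (deriv F (ℓ (z - a)) • ℓ) z :=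
    ((hF.differentiableAt (hG.mem_nhds (hmaps hz))).hasDerivAt).comp_hasFDerivAt z
      (ℓ.hasFDerivAt.comp z ((hasFDerivAt_id z).sub_const a))
  have hza : ‖ℓ (z - a)‖ = ‖l‖ * ‖ℓ X‖ := by
    rw [ha, sub_add_cancel_left, map_neg, map_smul, norm_neg, norm_smul]
  rw [hder.fderiv, smul_apply, norm_smul]
  simp only [hza]
  ring

end

section Metrics

variable {n : ℕ} {D : Set (Cn n)} {z X : Cn n}

lemma norm_fderiv_le_of_disc (hD : IsOpen D) {f : Cn n → ℂ} (hf : DifferentiableOn ℂ f D)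
    (hfm : MapsTo f D (ball 0 1)) (hz : f z = 0) {a : ℝ} (ha : 0 ≤ a) {φ : ℂ → Cn n}
    (hφ : DifferentiableOn ℂ φ (ball 0 1)) (hφm : MapsTo φ (ball 0 1) D) (hφ0 : φ 0 = z)
    (haX : a • fderiv ℂ φ 0 1 = X) : ‖fderiv ℂ f z X‖ ≤ a := by
  have h0 : (0 : ℂ) ∈ ball (0 : ℂ) 1 := mem_ball_self one_pos
  have hzD : φ 0 ∈ D := hφm h0
  have hs : ‖deriv (f ∘ φ) 0‖ ≤ 1 := norm_deriv_le_one_of_mapsTo_ball (hf.comp hφ hφm) (by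
    rw [Function.comp_apply, hφ0, hz]
    exact fun w hw => ball_subset_closedBall (hfm (hφm hw))) one_pos
  have hder : HasDerivAt (f ∘ φ) (fderiv ℂ f (φ 0) (fderiv ℂ φ 0 1)) 0 :=
    ((hf.differentiableAt (hD.mem_nhds hzD)).hasFDerivAt).comp_hasDerivAt 0
      (hφ.differentiableAt (isOpen_ball.mem_nhds h0)).hasFDerivAt.hasDerivAt
  rw [hder.deriv, hφ0] at hs
  rw [← haX, ContinuousLinearMap.map_smul_of_tower, norm_smul, Real.norm_of_nonneg ha]
  exact mul_le_of_le_one_right ha hs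

lemma exists_disc {r : ℝ} (hr : 0 < r) (hrD : ∀ l : ℂ, ‖l‖ < r → z + l • X ∈ D) :
    r⁻¹ ∈ {a : ℝ | 0 ≤ a ∧ ∃ φ : ℂ → Cn n, DifferentiableOn ℂ φ (ball (0:ℂ) 1) ∧
      MapsTo φ (ball (0:ℂ) 1) D ∧ φ 0 = z ∧ a • (fderiv ℂ φ 0 1) = X} := by
  refine ⟨(inv_pos.2 hr).le, fun l => z + (l * r) • X, by fun_prop, fun l hl => hrD _ ?_, by simp,
    ?_⟩
  · rw [norm_mul, norm_real, Real.norm_of_nonneg hr.le]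
    exact mul_lt_of_lt_one_left hr (mem_ball_zero_iff.1 hl)
  · have : HasDerivAt (fun l : ℂ => z + (l * r) • X) (((1 : ℂ) * r) • X) 0 :=
      (((hasDerivAt_id (0 : ℂ)).mul_const (r : ℂ)).smul_const X).const_add z
    have h1 : fderiv ℂ (fun l : ℂ => z + (l * r) • X) 0 1 = ((1 : ℂ) * r) • X := this.deriv
    rw [h1, one_mul, RCLike.real_smul_eq_coe_smul (K := ℂ), smul_smul]
    simp [hr.ne']

lemma kobMetric_mul_le {r : ℝ} (hr : 0 < r) (hrD : ∀ l : ℂ, ‖l‖ < r → z + l • X ∈ D) :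
    kobMetric D z X * r ≤ 1 := by
  have : kobMetric D z X ≤ r⁻¹ := csInf_le ⟨0, fun a ha => ha.1⟩ (exists_disc hr hrD)
  calc kobMetric D z X * r ≤ r⁻¹ * r := by gcongr
    _ = 1 := inv_mul_cancel₀ hr.ne'

lemma exists_pos_forall_mem (hD : IsOpen D) (hz : z ∈ D) :
    ∃ r : ℝ, 0 < r ∧ ∀ l : ℂ, ‖l‖ < r → z + l • X ∈ D := by
  have hc : Continuous fun l : ℂ => z + l • X := by fun_prop
  obtain ⟨r, hr, hball⟩ := Metric.mem_nhds_iff.1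
    (hc.continuousAt (x := (0 : ℂ)) (hD.mem_nhds (by simpa using hz)))
  exact ⟨r, hr, fun l hl => hball (mem_ball_zero_iff.2 hl)⟩

lemma le_of_mem_cara_of_mem_kob (hD : IsOpen D) {s : ℝ}
    (hs : s ∈ {r : ℝ | ∃ f : Cn n → ℂ, DifferentiableOn ℂ f D ∧ MapsTo f D (ball (0:ℂ) 1) ∧
      f z = 0 ∧ r = ‖fderiv ℂ f z X‖}) {a : ℝ}
    (ha : a ∈ {a : ℝ | 0 ≤ a ∧ ∃ φ : ℂ → Cn n, DifferentiableOn ℂ φ (ball (0:ℂ) 1) ∧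
      MapsTo φ (ball (0:ℂ) 1) D ∧ φ 0 = z ∧ a • (fderiv ℂ φ 0 1) = X}) : s ≤ a := by
  obtain ⟨f, hf, hfm, hfz, rfl⟩ := hs
  obtain ⟨ha0, φ, hφ, hφm, hφ0, haX⟩ := ha
  exact norm_fderiv_le_of_disc hD hf hfm hfz ha0 hφ hφm hφ0 haX

lemma norm_fderiv_le_caraMetric (hD : IsOpen D) (hz : z ∈ D) {f : Cn n → ℂ}
    (hf : DifferentiableOn ℂ f D) (hfm : MapsTo f D (ball 0 1)) (hfz : f z = 0) :
    ‖fderiv ℂ f z X‖ ≤ caraMetric D z X := by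
  obtain ⟨r, hr, hrD⟩ := exists_pos_forall_mem (X := X) hD hz
  exact le_csSup ⟨r⁻¹, fun s hs => le_of_mem_cara_of_mem_kob hD hs (exists_disc hr hrD)⟩
    ⟨f, hf, hfm, hfz, rfl⟩

lemma caraMetric_nonneg : 0 ≤ caraMetric D z X :=
  Real.sSup_nonneg fun _ ⟨_, _, _, _, hs⟩ => hs ▸ norm_nonneg _

lemma caraMetric_le_kobMetric (hD : IsOpen D) (hz : z ∈ D) :
    caraMetric D z X ≤ kobMetric D z X := by
  obtain ⟨r, hr, hrD⟩ := exists_pos_forall_mem (X := X) hD hz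
  refine csSup_le ⟨_, fun _ => 0, by fun_prop, fun _ _ => mem_ball_self one_pos, rfl, rfl⟩
    fun s hs => le_csInf ⟨_, exists_disc hr hrD⟩ fun a ha => le_of_mem_cara_of_mem_kob hD hs ha

lemma one_le_four_mul_caraMetric (hD : IsOpen D) (hsc : SliceSC D) (hz : z ∈ D) {l : ℂ}
    (hl : z + l • X ∉ D) : 1 ≤ 4 * ‖l‖ * caraMetric D z X := by
  refine le_of_forall_lt_imp_le_of_dense fun t ht => ?_
  rcases le_or_gt t 0 with ht0 | ht0
  · exact ht0.trans (mul_nonneg (by positivity) caraMetric_nonneg)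
  · obtain ⟨f, hf, hfm, hfz, hft⟩ := hsc.exists_le_norm_fderiv hD hz hl ht0 ht
    refine hft.trans ?_
    gcongr
    exact norm_fderiv_le_caraMetric hD hz hf hfm hfz

end Metrics

/-- For a ℂ-convex domain `D ⊊ ℂⁿ`, `z ∈ D` and `X ≠ 0` such that the
complex line through `z` in direction `X` is not contained in `D`, one has
`1/4 ≤ γ_D(z;X)·d_D(z,X) ≤ κ_D(z;X)·d_D(z,X) ≤ 1`. -/
theorem statement0 {n : ℕ} (D : Set (Cn n)) (hD : IsDomain' D) (hDne : D ≠ Set.univ)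
    (hcc : IsCConvex D) (z : Cn n) (hz : z ∈ D) (X : Cn n) (hX : X ≠ 0)
    (hline : ¬ cline z X ⊆ D) :
    1 / 4 ≤ caraMetric D z X * dirDist D z X ∧
      caraMetric D z X * dirDist D z X ≤ kobMetric D z X * dirDist D z X ∧
      kobMetric D z X * dirDist D z X ≤ 1 := by
  have hDo := hD.1
  obtain ⟨r, hr, hrD⟩ := exists_pos_forall_mem (X := X) hDo hz
  obtain ⟨l₀, hl₀⟩ : ∃ l : ℂ, z + l • X ∉ D := by
    by_contra! h
    exact hline fun w ⟨l, hl⟩ => hl ▸ h l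
  set S := {r : ℝ | 0 < r ∧ ∀ l : ℂ, ‖l‖ < r → z + l • X ∈ D} with hS
  have hSne : S.Nonempty := ⟨r, hr, hrD⟩
  have hSb : BddAbove S := ⟨‖l₀‖, fun s hs => not_lt.1 fun h => hl₀ (hs.2 l₀ h)⟩
  have hd : 0 < dirDist D z X := hr.trans_le (le_csSup hSb ⟨hr, hrD⟩)
  refine ⟨?_, ?_, ?_⟩
  · have key : ∀ d > dirDist D z X, 1 / 4 ≤ caraMetric D z X * d := by
      intro d hdd
      have hdS : d ∉ S := fun h => hdd.not_ge (le_csSup hSb h)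
      obtain ⟨l, hld, hl⟩ : ∃ l : ℂ, ‖l‖ < d ∧ z + l • X ∉ D := by
        by_contra! h
        exact hdS ⟨hd.trans hdd, h⟩
      have h1 := one_le_four_mul_caraMetric hDo hcc.sliceSC hz hl
      have h2 := mul_le_mul_of_nonneg_right hld.le (caraMetric_nonneg (D := D) (z := z) (X := X))
      linarith
    have hc : ContinuousWithinAt (fun d => caraMetric D z X * d) (Ioi (dirDist D z X))
        (dirDist D z X) := by fun_prop
    exact ge_of_tendsto hc (eventually_mem_nhdsWithin.mono key)
  · exact mul_le_mul_of_nonneg_right (caraMetric_le_kobMetric hDo hz) hd.le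
  · have hk : 0 < kobMetric D z X ∨ kobMetric D z X ≤ 0 := lt_or_ge _ _
    rcases hk with hk | hk
    · rw [mul_comm, ← le_div_iff₀ hk]
      exact csSup_le hSne fun s hs => (le_div_iff₀ hk).2
        (by rw [mul_comm]; exact kobMetric_mul_le hs.1 hs.2)
    · exact (mul_nonpos_of_nonpos_of_nonneg hk hd.le).trans zero_le_one

end
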